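/- arXiv:1807.00215 — 7 statements merged into one kernel-verified Lean document; each statement's English description precedes it below -/
import Mathlib

section
/- The maximum number of base pairs in a secondary structure on n positions (with hairpin parameter θ) equals ⌊(n−θ)/2⌋ when n ≥ θ, i.e. there exists a secondary structure with ⌊(n−θ)/2⌋ base pairs, and every secondary structure on n positions has at most ⌊(n−θ)/2⌋ base pairs. -/
/-- A base pair on a length-`n` homopolymer with hairpin parameter `θ`:
a pair `(i,j)` with `1 ≤ i < j ≤ n` and `j - i > θ`. -/
def IsBasePair (n θ : ℕ) (p : ℕ × ℕ) : Prop :=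
  1 ≤ p.1 ∧ p.1 < p.2 ∧ p.2 ≤ n ∧ θ < p.2 - p.1

/-- A secondary structure on `n` positions with hairpin parameter `θ`:
a set of base pairs, no position in two pairs, no two pairs crossing. -/
def IsSecStr (n θ : ℕ) (s : Finset (ℕ × ℕ)) : Prop :=
  (∀ p ∈ s, IsBasePair n θ p) ∧
  (∀ p ∈ s, ∀ q ∈ s, p ≠ q →
    p.1 ≠ q.1 ∧ p.1 ≠ q.2 ∧ p.2 ≠ q.1 ∧ p.2 ≠ q.2) ∧
  (∀ p ∈ s, ∀ q ∈ s, ¬ (p.1 < q.1 ∧ q.1 < p.2 ∧ p.2 < q.2))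

/-- `t` is obtained from `s` by adding or removing exactly one pair. -/
def Neighbor (s t : Finset (ℕ × ℕ)) : Prop :=
  (∃ p, p ∉ s ∧ t = insert p s) ∨ (∃ p, p ∈ s ∧ t = s.erase p)

/-- MS1 degree of `s`: the number of secondary structures on `n` positions
obtainable from `s` by adding or removing exactly one base pair. -/
noncomputable def degSS (n θ : ℕ) (s : Finset (ℕ × ℕ)) : ℕ :=
  Set.ncard {t : Finset (ℕ × ℕ) | IsSecStr n θ t ∧ Neighbor s t}

theorem stmt_3 (n θ : ℕ) (hn : θ ≤ n) :
    (∃ s : Finset (ℕ × ℕ), IsSecStr n θ s ∧ s.card = (n - θ) / 2) ∧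
    ∀ s : Finset (ℕ × ℕ), IsSecStr n θ s → s.card ≤ (n - θ) / 2 := by
  refine ⟨⟨(Finset.range ((n - θ) / 2)).image (fun k => (k + 1, n - k)), ⟨?_, ?_, ?_⟩, ?_⟩, ?_⟩
  · intro p hp
    obtain ⟨k, hk, rfl⟩ := Finset.mem_image.1 hp
    rw [Finset.mem_range] at hk
    simp only [IsBasePair]
    omega
  · intro p hp q hq hpq
    obtain ⟨k, hk, rfl⟩ := Finset.mem_image.1 hp
    obtain ⟨l, hl, rfl⟩ := Finset.mem_image.1 hq
    rw [Finset.mem_range] at hk hl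
    have hkl : k ≠ l := by
      rintro rfl
      exact hpq rfl
    simp only
    omega
  · intro p hp q hq
    obtain ⟨k, hk, rfl⟩ := Finset.mem_image.1 hp
    obtain ⟨l, hl, rfl⟩ := Finset.mem_image.1 hq
    rw [Finset.mem_range] at hk hl
    simp only
    omega
  · rw [Finset.card_image_of_injective, Finset.card_range]
    intro k l h
    have := congrArg Prod.fst h
    simpa using this
  · rintro s ⟨h1, h2, h3⟩
    rcases s.eq_empty_or_nonempty with rfl | hs
    · simp
    -- an innermost pair
    obtain ⟨a, ha, hmin⟩ := Finset.exists_min_image s (fun p => p.2 - p.1) hs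
    have hab := h1 a ha
    simp only [IsBasePair] at hab
    have c1 : (s.image Prod.fst).card = s.card := by
      apply Finset.card_image_of_injOn
      intro p hp q hq h
      by_contra hne
      exact (h2 p hp q hq hne).1 h
    have c2 : (s.image Prod.snd).card = s.card := by
      apply Finset.card_image_of_injOn
      intro p hp q hq h
      by_contra hne
      exact (h2 p hp q hq hne).2.2.2 h
    have hd : Disjoint (s.image Prod.fst) (s.image Prod.snd) := by
      rw [Finset.disjoint_left]
      intro x hx hy
      obtain ⟨p, hp, rfl⟩ := Finset.mem_image.1 hx
      obtain ⟨q, hq, h⟩ := Finset.mem_image.1 hy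
      by_cases hpq : p = q
      · subst hpq
        have := (h1 p hp).2.1
        omega
      · exact (h2 p hp q hq hpq).2.1 h.symm
    have key : ∀ p ∈ s, (1 ≤ p.1 ∧ p.2 ≤ n ∧ p.1 < p.2) ∧
        ¬ (a.1 < p.1 ∧ p.1 < a.2) ∧ ¬ (a.1 < p.2 ∧ p.2 < a.2) := by
      intro p hp
      have hb := h1 p hp
      simp only [IsBasePair] at hb
      have hm := hmin p hp
      have x1 := h3 p hp a ha
      have x2 := h3 a ha p hp
      by_cases hpa : p = a
      · subst hpa
        omega
      · have := h2 p hp a ha hpa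
        omega
    have hsub : s.image Prod.fst ∪ s.image Prod.snd ⊆ Finset.Icc 1 n \ Finset.Ioo a.1 a.2 := by
      intro x hx
      rw [Finset.mem_sdiff, Finset.mem_Icc, Finset.mem_Ioo]
      rcases Finset.mem_union.1 hx with hx | hx
      · obtain ⟨p, hp, rfl⟩ := Finset.mem_image.1 hx
        have := key p hp
        omega
      · obtain ⟨p, hp, rfl⟩ := Finset.mem_image.1 hx
        have := key p hp
        omega
    have hc := Finset.card_le_card hsub
    have hsub2 : Finset.Ioo a.1 a.2 ⊆ Finset.Icc 1 n := by
      intro x hx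
      rw [Finset.mem_Ioo] at hx
      rw [Finset.mem_Icc]
      omega
    rw [Finset.card_union_of_disjoint hd, c1, c2, Finset.card_sdiff_of_subset hsub2,
      Nat.card_Icc, Nat.card_Ioo] at hc
    omega
end

section
/- Let N(m) denote the number of secondary structures on m positions with hairpin parameter θ. Then N(m) = 1 for 1 ≤ m ≤ θ+1, and N(m) = N(m−1) + N(m−2) + Σ_{r=θ}^{m−3} N(m−r−2)·N(r) for θ+2 ≤ m. -/
/-- The number of secondary structures on `m` positions with hairpin parameter `θ`. -/
noncomputable def numSS (θ m : ℕ) : ℕ :=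
  Set.ncard {s : Finset (ℕ × ℕ) | IsSecStr m θ s}

open Classical in
/-- The finset of all secondary structures. -/
noncomputable def ssF (θ m : ℕ) : Finset (Finset (ℕ × ℕ)) :=
  ((Finset.range (m + 1) ×ˢ Finset.range (m + 1)).powerset).filter (fun s => IsSecStr m θ s)

open Classical in
theorem mem_ssF {θ m : ℕ} {s : Finset (ℕ × ℕ)} : s ∈ ssF θ m ↔ IsSecStr m θ s := by
  unfold ssF
  rw [Finset.mem_filter, Finset.mem_powerset]
  refine ⟨fun h => h.2, fun h => ⟨fun p hp => ?_, h⟩⟩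
  obtain ⟨h1, h2, h3, h4⟩ := h.1 p hp
  simp only [Finset.mem_product, Finset.mem_range]
  omega

theorem numSS_eq (θ m : ℕ) : numSS θ m = (ssF θ m).card := by
  unfold numSS
  rw [← Set.ncard_coe_finset]
  congr 1
  ext s
  simp [mem_ssF]

/-- Join an outer structure on `c` positions and an inner one under a closing pair. -/
def glue (c r : ℕ) (x : Finset (ℕ × ℕ) × Finset (ℕ × ℕ)) : Finset (ℕ × ℕ) :=
  insert (c + 1, c + r + 2) (x.1 ∪ x.2.image (fun q => (q.1 + c + 1, q.2 + c + 1)))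

theorem mem_glue {c r : ℕ} {x : Finset (ℕ × ℕ) × Finset (ℕ × ℕ)} {p : ℕ × ℕ} :
    p ∈ glue c r x ↔ p = (c + 1, c + r + 2) ∨ p ∈ x.1 ∨
      ∃ q ∈ x.2, (q.1 + c + 1, q.2 + c + 1) = p := by
  simp [glue]

theorem glue_isSecStr {θ c r : ℕ} (hr : θ ≤ r) {a b : Finset (ℕ × ℕ)}
    (ha : IsSecStr c θ a) (hb : IsSecStr r θ b) :
    IsSecStr (c + r + 2) θ (glue c r (a, b)) := by
  obtain ⟨a1, a2, a3⟩ := ha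
  obtain ⟨b1, b2, b3⟩ := hb
  unfold IsBasePair at *
  refine ⟨?_, ?_, ?_⟩
  · intro p hp
    unfold IsBasePair
    rcases mem_glue.1 hp with rfl | h | ⟨q, h, rfl⟩
    · dsimp only; omega
    · have := a1 p h; omega
    · have := b1 q h; dsimp only; omega
  · intro p hp p' hp' hne
    rcases mem_glue.1 hp with rfl | h | ⟨q, h, rfl⟩ <;>
    rcases mem_glue.1 hp' with rfl | h' | ⟨q', h', rfl⟩
    · exact absurd rfl hne
    · have := a1 _ h'; dsimp only; omega
    · have := b1 _ h'; dsimp only; omega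
    · have := a1 _ h; dsimp only; omega
    · exact a2 _ h _ h' hne
    · have := a1 _ h; have := b1 _ h'; dsimp only; omega
    · have := b1 _ h; dsimp only; omega
    · have := a1 _ h'; have := b1 _ h; dsimp only; omega
    · have := b2 _ h _ h' (by rintro rfl; exact hne rfl)
      dsimp only; omega
  · intro p hp p' hp'
    rcases mem_glue.1 hp with rfl | h | ⟨q, h, rfl⟩ <;>
    rcases mem_glue.1 hp' with rfl | h' | ⟨q', h', rfl⟩
    · dsimp only; omega
    · have := a1 _ h'; dsimp only; omega
    · have := b1 _ h'; dsimp only; omega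
    · have := a1 _ h; dsimp only; omega
    · exact a3 _ h _ h'
    · have := a1 _ h; have := b1 _ h'; dsimp only; omega
    · have := b1 _ h; dsimp only; omega
    · have := a1 _ h'; have := b1 _ h; dsimp only; omega
    · have := b3 _ h _ h'
      dsimp only; omega

theorem exists_glue {θ c r : ℕ} {s : Finset (ℕ × ℕ)}
    (hs : IsSecStr (c + r + 2) θ s) (hm : (c + 1, c + r + 2) ∈ s) :
    ∃ a b, IsSecStr c θ a ∧ IsSecStr r θ b ∧ glue c r (a, b) = s := by
  obtain ⟨s1, s2, s3⟩ := hs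
  unfold IsBasePair at *
  have hb : ∀ q : ℕ × ℕ, q ∈ (s.filter (fun p => c + 1 < p.1 ∧ p.2 < c + r + 2)).image
      (fun p => (p.1 - (c + 1), p.2 - (c + 1))) ↔
      (q.1 + c + 1, q.2 + c + 1) ∈ s ∧ 1 ≤ q.1 ∧ q.2 ≤ r := by
    intro q
    simp only [Finset.mem_image, Finset.mem_filter]
    constructor
    · rintro ⟨p, ⟨hp, h1, h2⟩, rfl⟩
      have := s1 p hp
      have e : (p.1 - (c + 1) + c + 1, p.2 - (c + 1) + c + 1) = p := by
        ext <;> dsimp only <;> omega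
      dsimp only
      rw [e]
      exact ⟨hp, by omega, by omega⟩
    · rintro ⟨h, h1, h2⟩
      refine ⟨_, ⟨h, ?_, ?_⟩, ?_⟩
      · dsimp only; omega
      · dsimp only; omega
      · ext <;> dsimp only <;> omega
  refine ⟨s.filter (fun p => p.2 ≤ c), (s.filter (fun p => c + 1 < p.1 ∧ p.2 < c + r + 2)).image
      (fun p => (p.1 - (c + 1), p.2 - (c + 1))), ⟨?_, ?_, ?_⟩, ⟨?_, ?_, ?_⟩, ?_⟩
  · intro p hp
    rw [Finset.mem_filter] at hp
    have := s1 p hp.1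
    unfold IsBasePair; omega
  · intro p hp q hq
    exact s2 p (Finset.mem_filter.1 hp).1 q (Finset.mem_filter.1 hq).1
  · intro p hp q hq
    exact s3 p (Finset.mem_filter.1 hp).1 q (Finset.mem_filter.1 hq).1
  · intro p hp
    rw [hb] at hp
    have := s1 _ hp.1
    dsimp only at this
    unfold IsBasePair; omega
  · intro p hp q hq hne
    rw [hb] at hp hq
    have := s2 _ hp.1 _ hq.1 (by
      intro h; apply hne
      rw [Prod.mk.injEq] at h
      ext <;> omega)
    dsimp only at this
    omega
  · intro p hp q hq
    rw [hb] at hp hq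
    have := s3 _ hp.1 _ hq.1
    dsimp only at this
    omega
  · ext p
    rw [mem_glue]
    dsimp only
    constructor
    · rintro (rfl | h | ⟨q, hq, rfl⟩)
      · exact hm
      · exact (Finset.mem_filter.1 h).1
      · exact ((hb q).1 hq).1
    · intro hp
      by_cases hpe : p = (c + 1, c + r + 2)
      · exact Or.inl hpe
      right
      have h1 := s1 p hp
      have h2 := s2 p hp _ hm hpe
      have h3 := s3 p hp _ hm
      dsimp only at h2 h3
      by_cases hc : p.2 ≤ c
      · exact Or.inl (Finset.mem_filter.2 ⟨hp, hc⟩)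
      · right
        have e : (p.1 - (c + 1) + c + 1, p.2 - (c + 1) + c + 1) = p := by
          ext <;> dsimp only <;> omega
        refine ⟨(p.1 - (c + 1), p.2 - (c + 1)), (hb _).2 ?_, e⟩
        dsimp only
        rw [e]
        exact ⟨hp, by omega, by omega⟩

theorem glue_left {θ c r : ℕ} {a b : Finset (ℕ × ℕ)}
    (ha : IsSecStr c θ a) (p : ℕ × ℕ) :
    p ∈ a ↔ p ∈ glue c r (a, b) ∧ p.2 ≤ c := by
  rw [mem_glue]
  constructor
  · intro h
    exact ⟨Or.inr (Or.inl h), (ha.1 p h).2.2.1⟩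
  · rintro ⟨rfl | h | ⟨q, hq, rfl⟩, h2⟩
    · dsimp only at h2; omega
    · exact h
    · dsimp only at h2; omega

theorem glue_right {θ c r : ℕ} {a b : Finset (ℕ × ℕ)}
    (ha : IsSecStr c θ a) (hb : IsSecStr r θ b) (p : ℕ × ℕ) :
    p ∈ b ↔ (p.1 + c + 1, p.2 + c + 1) ∈ glue c r (a, b) ∧ 1 ≤ p.1 := by
  rw [mem_glue]
  constructor
  · intro h
    exact ⟨Or.inr (Or.inr ⟨p, h, rfl⟩), (hb.1 p h).1⟩
  · rintro ⟨h | h | ⟨q, hq, h⟩, h2⟩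
    · rw [Prod.mk.injEq] at h; omega
    · have := (ha.1 _ h).2.2.1; dsimp only at this; omega
    · rw [Prod.mk.injEq] at h
      have : q = p := by ext <;> omega
      exact this ▸ hq

theorem glue_injOn (θ c r : ℕ) :
    Set.InjOn (glue c r) (ssF θ c ×ˢ ssF θ r : Finset _) := by
  rintro ⟨a, b⟩ h ⟨a', b'⟩ h' e
  simp only [Finset.coe_product, Set.mem_prod, Finset.mem_coe, mem_ssF] at h h'
  have e1 : a = a' := by
    ext p
    rw [glue_left (r := r) (b := b) h.1, glue_left (r := r) (b := b') h'.1, e]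
  have e2 : b = b' := by
    ext p
    rw [glue_right h.1 h.2, glue_right h'.1 h'.2, e]
  rw [e1, e2]

theorem ssF_split (θ n : ℕ) :
    ssF θ (n + 2) = ssF θ (n + 1) ∪
      (Finset.Ico θ (n + 1)).biUnion
        (fun r => (ssF θ (n - r) ×ˢ ssF θ r).image (glue (n - r) r)) := by
  ext s
  simp only [Finset.mem_union, Finset.mem_biUnion, Finset.mem_image, Finset.mem_product, mem_ssF,
    Finset.mem_Ico]
  constructor
  · intro hs
    by_cases h : ∃ p ∈ s, p.2 = n + 2
    · right
      obtain ⟨⟨i, j⟩, hp, hj⟩ := h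
      dsimp only at hj
      subst hj
      have h1 := hs.1 _ hp
      unfold IsBasePair at h1
      dsimp only at h1
      obtain ⟨c, rfl⟩ : ∃ c, i = c + 1 := ⟨i - 1, by omega⟩
      obtain ⟨r, rfl⟩ : ∃ r, n = c + r := ⟨n - c, by omega⟩
      obtain ⟨a, b, ha, hb, e⟩ := exists_glue hs hp
      refine ⟨r, by omega, (a, b), ?_⟩
      rw [Nat.add_sub_cancel]
      exact ⟨⟨ha, hb⟩, e⟩
    · left
      push Not at h
      refine ⟨fun p hp => ?_, hs.2⟩
      have := hs.1 p hp
      have := h p hp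
      unfold IsBasePair at *
      omega
  · rintro (hs | ⟨r, hr, ⟨a, b⟩, ⟨ha, hb⟩, rfl⟩)
    · refine ⟨fun p hp => ?_, hs.2⟩
      have := hs.1 p hp
      unfold IsBasePair at *
      omega
    · have := glue_isSecStr hr.1 ha hb
      rwa [show n - r + r + 2 = n + 2 by omega] at this

theorem card_split (θ n : ℕ) :
    (ssF θ (n + 2)).card = (ssF θ (n + 1)).card +
      ∑ r ∈ Finset.Ico θ (n + 1), (ssF θ (n - r)).card * (ssF θ r).card := by
  rw [ssF_split, Finset.card_union_of_disjoint, Finset.card_biUnion]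
  · congr 1
    refine Finset.sum_congr rfl fun r _ => ?_
    rw [Finset.card_image_of_injOn (glue_injOn _ _ _), Finset.card_product]
  · intro r hr r' hr' hne
    rw [Function.onFun, Finset.disjoint_left]
    intro s hs hs'
    simp only [Finset.mem_image, Finset.mem_product, mem_ssF, Finset.coe_Ico,
      Set.mem_Ico] at hs hs' hr hr'
    obtain ⟨⟨a, b⟩, ⟨ha, hb⟩, rfl⟩ := hs
    obtain ⟨⟨a', b'⟩, -, e⟩ := hs'
    have m1 : (n - r + 1, n - r + r + 2) ∈ glue (n - r) r (a, b) := mem_glue.2 (Or.inl rfl)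
    have m2 : (n - r' + 1, n - r' + r' + 2) ∈ glue (n - r) r (a, b) := by
      rw [← e]; exact mem_glue.2 (Or.inl rfl)
    have := (glue_isSecStr hr.1 ha hb).2.1 _ m1 _ m2 (by
      intro h; rw [Prod.mk.injEq] at h; omega)
    dsimp only at this
    omega
  · rw [Finset.disjoint_left]
    intro s hs hs'
    simp only [Finset.mem_biUnion, Finset.mem_image, Finset.mem_product, mem_ssF,
      Finset.mem_Ico] at hs hs'
    obtain ⟨r, hr, ⟨a, b⟩, -, rfl⟩ := hs'
    have := (hs.1 (n - r + 1, n - r + r + 2) (mem_glue.2 (Or.inl rfl))).2.2.1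
    dsimp only at this
    omega

theorem numSS_small (θ m : ℕ) (hm : m ≤ θ + 1) : numSS θ m = 1 := by
  rw [numSS_eq, Finset.card_eq_one]
  refine ⟨∅, ?_⟩
  ext s
  rw [mem_ssF, Finset.mem_singleton]
  constructor
  · intro h
    rw [Finset.eq_empty_iff_forall_notMem]
    intro p hp
    have := h.1 p hp
    unfold IsBasePair at this
    omega
  · rintro rfl
    simp [IsSecStr]

theorem stmt_4 (θ : ℕ) :
    (∀ m, 1 ≤ m → m ≤ θ + 1 → numSS θ m = 1) ∧
    (∀ m, θ + 2 ≤ m →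
      numSS θ m = numSS θ (m - 1) + numSS θ (m - 2) +
        ∑ r ∈ Finset.Ico θ (m - 2), numSS θ (m - r - 2) * numSS θ r) := by
  refine ⟨fun m _ h => numSS_small θ m h, fun m hm => ?_⟩
  obtain ⟨n, rfl⟩ : ∃ n, m = n + 2 := ⟨m - 2, by omega⟩
  have h := card_split θ n
  simp only [← numSS_eq] at h
  rw [Finset.sum_Ico_succ_top (by omega), Nat.sub_self, numSS_small θ 0 (by omega), one_mul] at h
  rw [show n + 2 - 1 = n + 1 by omega, show n + 2 - 2 = n by omega, h]
  have : ∀ r, n + 2 - r - 2 = n - r := fun r => by omega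
  simp only [this]
  ring
end

section
/- For every pseudo-secondary structure s on n positions, the degree of s equals |s| + C(n−2|s|, 2), where C(·,2) is the binomial coefficient. -/
/-- A pseudo-secondary structure on `n` positions: a partial matching on
`{1,…,n}`, i.e. a set of pairs `(i,j)` with `1 ≤ i < j ≤ n` in which no
position occurs in more than one pair (crossings allowed, θ = 0). -/
def IsPseudo (n : ℕ) (s : Finset (ℕ × ℕ)) : Prop :=
  (∀ p ∈ s, 1 ≤ p.1 ∧ p.1 < p.2 ∧ p.2 ≤ n) ∧
  (∀ p ∈ s, ∀ q ∈ s, p ≠ q →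
    p.1 ≠ q.1 ∧ p.1 ≠ q.2 ∧ p.2 ≠ q.1 ∧ p.2 ≠ q.2)

/-- The degree `dg` of a pseudo-secondary structure `s` on `n` positions:
the number of pseudo-secondary structures on `n` positions obtainable from
`s` by adding or removing exactly one pair. -/
noncomputable def dg (n : ℕ) (s : Finset (ℕ × ℕ)) : ℕ :=
  Set.ncard {t : Finset (ℕ × ℕ) | IsPseudo n t ∧ Neighbor s t}


lemma card_ltPairs (U : Finset ℕ) :
    ((U ×ˢ U).filter (fun p => p.1 < p.2)).card = U.card.choose 2 := by
  rw [← Finset.card_powersetCard]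
  apply Finset.card_bij (fun p _ => ({p.1, p.2} : Finset ℕ))
  · rintro ⟨a, b⟩ h
    simp only [Finset.mem_filter, Finset.mem_product] at h
    rw [Finset.mem_powersetCard]
    refine ⟨?_, Finset.card_pair h.2.ne⟩
    intro x hx
    simp only [Finset.mem_insert, Finset.mem_singleton] at hx
    rcases hx with rfl | rfl
    · exact h.1.1
    · exact h.1.2
  · rintro ⟨a, b⟩ h ⟨c, d⟩ h' e
    simp only [Finset.mem_filter, Finset.mem_product] at h h'
    replace e : ({a, b} : Finset ℕ) = {c, d} := e
    have h1 := Finset.ext_iff.1 e a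
    have h2 := Finset.ext_iff.1 e b
    have h3 := Finset.ext_iff.1 e c
    have h4 := Finset.ext_iff.1 e d
    simp only [Finset.mem_insert, Finset.mem_singleton] at h1 h2 h3 h4
    simp only [true_or, or_true, true_iff, iff_true] at h1 h2 h3 h4
    rw [Prod.mk.injEq]
    omega
  · intro t ht
    rw [Finset.mem_powersetCard, Finset.card_eq_two] at ht
    obtain ⟨hU, a, b, hab, rfl⟩ := ht
    have ha : a ∈ U := hU (by simp)
    have hb : b ∈ U := hU (by simp)
    rcases lt_or_gt_of_ne hab with h | h
    · exact ⟨(a, b), by simp [ha, hb, h], rfl⟩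
    · exact ⟨(b, a), by simp [ha, hb, h], Finset.pair_comm _ _⟩

/-- Occupied positions. -/
def occ (s : Finset (ℕ × ℕ)) : Finset ℕ := s.biUnion (fun p => {p.1, p.2})

lemma mem_occ (s : Finset (ℕ × ℕ)) (x : ℕ) :
    x ∈ occ s ↔ ∃ p ∈ s, x = p.1 ∨ x = p.2 := by
  simp [occ]

lemma card_occ {n : ℕ} {s : Finset (ℕ × ℕ)} (hs : IsPseudo n s) :
    (occ s).card = 2 * s.card := by
  unfold occ
  rw [Finset.card_biUnion]
  · rw [Finset.sum_congr rfl (fun p hp => Finset.card_pair (hs.1 p hp).2.1.ne)]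
    simp [mul_comm]
  · intro p hp q hq hpq
    have := hs.2 p hp q hq hpq
    refine Finset.disjoint_left.2 ?_
    intro x hx hx'
    simp only [Finset.mem_insert, Finset.mem_singleton] at hx hx'
    omega

lemma isPseudo_insert {n : ℕ} {s : Finset (ℕ × ℕ)} (hs : IsPseudo n s) (p : ℕ × ℕ) :
    (p ∉ s ∧ IsPseudo n (insert p s)) ↔
      p ∈ (((Finset.Icc 1 n \ occ s) ×ˢ (Finset.Icc 1 n \ occ s)).filter
        (fun p => p.1 < p.2)) := by
  simp only [Finset.mem_filter, Finset.mem_product, Finset.mem_sdiff, Finset.mem_Icc, mem_occ]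
  constructor
  · rintro ⟨hp, h1, h2⟩
    have := h1 p (by simp)
    refine ⟨⟨⟨by omega, ?_⟩, ⟨by omega, ?_⟩⟩, this.2.1⟩ <;>
    · rintro ⟨q, hq, e⟩
      have := h2 p (by simp) q (by simp [hq]) (by rintro rfl; exact hp hq)
      omega
  · rintro ⟨⟨⟨ha, ha'⟩, ⟨hb, hb'⟩⟩, hlt⟩
    have key : ∀ q ∈ s, p.1 ≠ q.1 ∧ p.1 ≠ q.2 ∧ p.2 ≠ q.1 ∧ p.2 ≠ q.2 := fun q hq =>
      ⟨fun e => ha' ⟨q, hq, Or.inl e⟩, fun e => ha' ⟨q, hq, Or.inr e⟩,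
       fun e => hb' ⟨q, hq, Or.inl e⟩, fun e => hb' ⟨q, hq, Or.inr e⟩⟩
    refine ⟨fun h => (key p h).1 rfl, ?_, ?_⟩
    · intro q hq
      rcases Finset.mem_insert.1 hq with rfl | hq
      · omega
      · exact hs.1 q hq
    · intro q hq r hr hqr
      rcases Finset.mem_insert.1 hq with rfl | hq2 <;> rcases Finset.mem_insert.1 hr with rfl | hr2
      · exact absurd rfl hqr
      · exact key r hr2
      · have := key q hq2
        omega
      · exact hs.2 q hq2 r hr2 hqr

theorem stmt_5 (n : ℕ) (s : Finset (ℕ × ℕ)) (hs : IsPseudo n s) :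
    dg n s = s.card + (n - 2 * s.card).choose 2 := by
  have hU : (Finset.Icc 1 n \ occ s).card = n - 2 * s.card := by
    rw [Finset.card_sdiff_of_subset, card_occ hs]
    · simp
    · intro x hx
      obtain ⟨p, hp, e⟩ := (mem_occ s x).1 hx
      have := hs.1 p hp
      rw [Finset.mem_Icc]
      omega
  rw [← hU, ← card_ltPairs]
  set A := (((Finset.Icc 1 n \ occ s) ×ˢ (Finset.Icc 1 n \ occ s)).filter
        (fun p => p.1 < p.2)) with hA
  have hAm : ∀ p, (p ∉ s ∧ IsPseudo n (insert p s)) ↔ p ∈ A := isPseudo_insert hs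
  have hset : {t : Finset (ℕ × ℕ) | IsPseudo n t ∧ Neighbor s t} =
      ((s.image (fun p => s.erase p) ∪ A.image (fun p => insert p s) :
        Finset (Finset (ℕ × ℕ))) : Set (Finset (ℕ × ℕ))) := by
    ext t
    simp only [Set.mem_setOf_eq, Finset.coe_union, Finset.coe_image, Set.mem_union,
      Set.mem_image, Finset.mem_coe]
    constructor
    · rintro ⟨ht, ⟨p, hp, rfl⟩ | ⟨p, hp, rfl⟩⟩
      · exact Or.inr ⟨p, (hAm p).1 ⟨hp, ht⟩, rfl⟩
      · exact Or.inl ⟨p, hp, rfl⟩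
    · rintro (⟨p, hp, rfl⟩ | ⟨p, hp, rfl⟩)
      · exact ⟨⟨fun q hq => hs.1 q (Finset.mem_of_mem_erase hq),
          fun q hq r hr => hs.2 q (Finset.mem_of_mem_erase hq) r (Finset.mem_of_mem_erase hr)⟩,
          Or.inr ⟨p, hp, rfl⟩⟩
      · have := (hAm p).2 hp
        exact ⟨this.2, Or.inl ⟨p, this.1, rfl⟩⟩
  unfold dg
  rw [hset, Set.ncard_coe_finset, Finset.card_union_of_disjoint, Finset.card_image_of_injOn,
    Finset.card_image_of_injOn]
  · intro p hp q hq e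
    have hp' := ((hAm p).2 hp).1
    have : p ∈ insert q s := by
      rw [← show insert p s = insert q s from e]
      simp
    exact (Finset.mem_insert.1 this).resolve_right hp'
  · intro p hp q hq e
    by_contra hne
    have : p ∈ s.erase q := Finset.mem_erase.2 ⟨hne, hp⟩
    rw [← show s.erase p = s.erase q from e] at this
    simp at this
  · rw [Finset.disjoint_left]
    intro t h1 h2
    obtain ⟨p, hp, rfl⟩ := Finset.mem_image.1 h1
    obtain ⟨q, hq, e⟩ := Finset.mem_image.1 h2
    have : p ∈ s.erase p := by
      rw [← e]
      exact Finset.mem_insert_of_mem hp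
    simp at this
end

section
/- Let s and t be pseudo-secondary structures on n positions with |s| = |t| − k for some integer k ≥ 0 (so |s| ≤ |t|). Then, as integers, dg(s) − dg(t) = 2kn − 4k|t| + 2k(k−1); in particular dg(s) − dg(t) ≥ 2k(k−1). -/
/-- The unpaired positions. -/
def freePos (n : ℕ) (s : Finset (ℕ × ℕ)) : Finset ℕ :=
  Finset.Icc 1 n \ (s.image Prod.fst ∪ s.image Prod.snd)

lemma card_freePos (n : ℕ) (s : Finset (ℕ × ℕ)) (hs : IsPseudo n s) :
    (freePos n s).card + 2 * s.card = n := by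
  obtain ⟨h1, h2⟩ := hs
  have hsub : s.image Prod.fst ∪ s.image Prod.snd ⊆ Finset.Icc 1 n := by
    intro x hx
    simp only [Finset.mem_union, Finset.mem_image] at hx
    rw [Finset.mem_Icc]
    rcases hx with ⟨p, hp, rfl⟩ | ⟨p, hp, rfl⟩ <;> have := h1 p hp <;> omega
  have hf : (s.image Prod.fst).card = s.card := by
    apply Finset.card_image_of_injOn
    intro p hp q hq h
    by_contra hne
    exact (h2 p hp q hq hne).1 h
  have hg : (s.image Prod.snd).card = s.card := by
    apply Finset.card_image_of_injOn
    intro p hp q hq h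
    by_contra hne
    exact (h2 p hp q hq hne).2.2.2 h
  have hd : Disjoint (s.image Prod.fst) (s.image Prod.snd) := by
    rw [Finset.disjoint_left]
    intro x hx hy
    rw [Finset.mem_image] at hx hy
    obtain ⟨p, hp, rfl⟩ := hx
    obtain ⟨q, hq, h⟩ := hy
    by_cases hne : p = q
    · subst hne
      have := h1 p hp
      omega
    · exact (h2 p hp q hq hne).2.1 h.symm
  have := Finset.card_sdiff_add_card_eq_card hsub
  rw [Finset.card_union_of_disjoint hd, hf, hg, Nat.card_Icc] at this
  unfold freePos
  omega

lemma card_lt_pairs (F : Finset ℕ) :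
    2 * ((F ×ˢ F).filter (fun p => p.1 < p.2)).card + F.card = F.card * F.card := by
  have hsw : ((F ×ˢ F).filter (fun p => p.2 < p.1)).card
      = ((F ×ˢ F).filter (fun p => p.1 < p.2)).card := by
    apply Finset.card_bij' (fun p _ => p.swap) (fun p _ => p.swap) <;> simp <;> tauto
  have hu : F.offDiag = (F ×ˢ F).filter (fun p => p.1 < p.2) ∪
      (F ×ˢ F).filter (fun p => p.2 < p.1) := by
    ext p
    simp only [Finset.mem_offDiag, Finset.mem_union, Finset.mem_filter, Finset.mem_product]
    have : p.1 ≠ p.2 ↔ p.1 < p.2 ∨ p.2 < p.1 := by omega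
    tauto
  have hd : Disjoint ((F ×ˢ F).filter (fun p => p.1 < p.2))
      ((F ×ˢ F).filter (fun p => p.2 < p.1)) := by
    rw [Finset.disjoint_left]
    intro p hp hq
    rw [Finset.mem_filter] at hp hq
    omega
  have h := F.offDiag_card
  rw [hu, Finset.card_union_of_disjoint hd, hsw] at h
  have := Nat.le_mul_self F.card
  omega

lemma pseudo_insert (n : ℕ) (s : Finset (ℕ × ℕ)) (hs : IsPseudo n s) (p : ℕ × ℕ) :
    (p ∉ s ∧ IsPseudo n (insert p s)) ↔
      p ∈ (freePos n s ×ˢ freePos n s).filter (fun p => p.1 < p.2) := by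
  obtain ⟨h1, h2⟩ := hs
  simp only [Finset.mem_filter, Finset.mem_product, freePos, Finset.mem_sdiff, Finset.mem_Icc,
    Finset.mem_union, Finset.mem_image, not_or, not_exists, not_and]
  constructor
  · rintro ⟨hp, g1, g2⟩
    have a := g1 p (Finset.mem_insert_self _ _)
    have b : ∀ q ∈ s, p.1 ≠ q.1 ∧ p.1 ≠ q.2 ∧ p.2 ≠ q.1 ∧ p.2 ≠ q.2 := fun q hq =>
      g2 p (Finset.mem_insert_self _ _) q (Finset.mem_insert_of_mem hq)
        (fun h => hp (h ▸ hq))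
    refine ⟨⟨⟨by omega, ?_, ?_⟩, by omega, ?_, ?_⟩, a.2.1⟩ <;> intro q hq <;>
      have := b q hq <;> omega
  · rintro ⟨⟨⟨a, b, c⟩, d, e, f⟩, g⟩
    refine ⟨fun hp => b p hp rfl, ?_, ?_⟩
    · intro q hq
      rcases Finset.mem_insert.1 hq with rfl | hq
      · omega
      · exact h1 q hq
    · intro q hq r hr hne
      rcases Finset.mem_insert.1 hq with rfl | hq2 <;>
        rcases Finset.mem_insert.1 hr with rfl | hr2
      · exact absurd rfl hne
      · have := b r hr2; have := c r hr2; have := e r hr2; have := f r hr2; omega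
      · have := b q hq2; have := c q hq2; have := e q hq2; have := f q hq2; omega
      · exact h2 q hq2 r hr2 hne

lemma dg_eq (n : ℕ) (s : Finset (ℕ × ℕ)) (hs : IsPseudo n s) :
    dg n s = ((freePos n s ×ˢ freePos n s).filter (fun p => p.1 < p.2)).card + s.card := by
  have hset : {t : Finset (ℕ × ℕ) | IsPseudo n t ∧ Neighbor s t} =
      (↑(((freePos n s ×ˢ freePos n s).filter (fun p => p.1 < p.2)).image (fun p => insert p s)
        ∪ s.image (fun p => s.erase p)) : Set (Finset (ℕ × ℕ))) := by
    ext t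
    simp only [Set.mem_setOf_eq, Finset.mem_coe, Finset.mem_union]
    rw [Finset.mem_image, Finset.mem_image]
    constructor
    · rintro ⟨ht, ⟨p, hp, rfl⟩ | ⟨p, hp, rfl⟩⟩
      · exact Or.inl ⟨p, (pseudo_insert n s hs p).1 ⟨hp, ht⟩, rfl⟩
      · exact Or.inr ⟨p, hp, rfl⟩
    · rintro (⟨p, hp, rfl⟩ | ⟨p, hp, rfl⟩)
      · have := (pseudo_insert n s hs p).2 hp
        exact ⟨this.2, Or.inl ⟨p, this.1, rfl⟩⟩
      · exact ⟨⟨fun q hq => hs.1 q (Finset.mem_of_mem_erase hq), fun q hq r hr =>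
          hs.2 q (Finset.mem_of_mem_erase hq) r (Finset.mem_of_mem_erase hr)⟩,
          Or.inr ⟨p, hp, rfl⟩⟩
  unfold dg
  rw [hset, Set.ncard_coe_finset, Finset.card_union_of_disjoint, Finset.card_image_of_injOn,
    Finset.card_image_of_injOn]
  · intro p hp q hq h
    by_contra hne
    have h' : s.erase p = s.erase q := h
    have : p ∈ s.erase q := Finset.mem_erase.2 ⟨hne, hp⟩
    rw [← h'] at this
    exact Finset.notMem_erase p s this
  · intro p hp q hq h
    have h' : insert p s = insert q s := h
    have : p ∈ insert q s := h' ▸ Finset.mem_insert_self p s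
    rcases Finset.mem_insert.1 this with h | h
    · exact h
    · exact absurd h ((pseudo_insert n s hs p).2 hp).1
  · rw [Finset.disjoint_left]
    intro t hx hy
    rw [Finset.mem_image] at hx hy
    obtain ⟨p, hp, rfl⟩ := hx
    obtain ⟨q, hq, h⟩ := hy
    have : q ∈ s.erase q := by
      rw [h]
      exact Finset.mem_insert_of_mem hq
    exact Finset.notMem_erase q s this

theorem stmt_9 (n k : ℕ) (s t : Finset (ℕ × ℕ)) (hs : IsPseudo n s)
    (ht : IsPseudo n t) (hk : s.card + k = t.card) :
    (dg n s : ℤ) - (dg n t : ℤ) =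
      2 * (k : ℤ) * n - 4 * (k : ℤ) * t.card + 2 * (k : ℤ) * ((k : ℤ) - 1) ∧
    (dg n s : ℤ) - (dg n t : ℤ) ≥ 2 * (k : ℤ) * ((k : ℤ) - 1) := by
  have a := dg_eq n s hs
  have b := dg_eq n t ht
  have c := card_lt_pairs (freePos n s)
  have d := card_lt_pairs (freePos n t)
  have e := card_freePos n s hs
  have f := card_freePos n t ht
  generalize ((freePos n s ×ˢ freePos n s).filter (fun p => p.1 < p.2)).card = x at *
  generalize ((freePos n t ×ˢ freePos n t).filter (fun p => p.1 < p.2)).card = y at *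
  generalize (freePos n s).card = u at *
  generalize (freePos n t).card = v at *
  have hu : u = v + 2 * k := by omega
  subst hu
  have key : (dg n s : ℤ) - (dg n t : ℤ) = 2 * k * v + 2 * (k : ℤ) * ((k : ℤ) - 1) := by
    rw [a, b]
    zify at c d hk
    push_cast
    linarith
  have hn : (n : ℤ) = v + 2 * t.card := by omega
  constructor
  · rw [key, hn]
    ring
  · rw [key]
    have : (0 : ℤ) ≤ 2 * k * v := by positivity
    linarith
end

section
/- Let n be even, let s, t be pseudo-secondary structures on n positions with dg(s) ≥ dg(t), and let s', t' be pseudo-secondary structures on n+1 positions with s ≺ s', t ≺ t'. If |s'| = |s| and |t'| = |t| + 1, then dg(s') ≥ dg(t'). -/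
/-- `s'` (on `n+1` positions) extends `s` (on `n` positions), written `s ≺ s'`:
either `s' = s` (position `n+1` unpaired), or `s' = s ∪ {(k, n+1)}` for some
position `k ∈ {1,…,n}` unpaired in `s`. -/
def ExtendsTo (n : ℕ) (s s' : Finset (ℕ × ℕ)) : Prop :=
  s' = s ∨ ∃ k, 1 ≤ k ∧ k ≤ n ∧ (∀ p ∈ s, p.1 ≠ k ∧ p.2 ≠ k) ∧
    s' = insert (k, n + 1) s

theorem pseudo_finite (n : ℕ) (s : Finset (ℕ × ℕ)) :
    {t : Finset (ℕ × ℕ) | IsPseudo n t ∧ Neighbor s t}.Finite := by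
  apply Set.Finite.subset
    ((Finset.Icc 1 n ×ˢ Finset.Icc 1 n).powerset.finite_toSet)
  rintro t ⟨ht, -⟩
  simp only [Finset.mem_coe, Finset.mem_powerset]
  intro p hp
  have := ht.1 p hp
  simp only [Finset.mem_product, Finset.mem_Icc]
  omega

theorem IsPseudo.mono {n : ℕ} {s : Finset (ℕ × ℕ)} (h : IsPseudo n s) :
    IsPseudo (n + 1) s :=
  ⟨fun p hp => by have := h.1 p hp; omega, h.2⟩

theorem dg_mono (n : ℕ) (s : Finset (ℕ × ℕ)) : dg n s ≤ dg (n + 1) s :=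
  Set.ncard_le_ncard (fun _ h => ⟨h.1.mono, h.2⟩) (pseudo_finite _ _)

/-- The set of paired positions has even size. -/
theorem card_paired {n : ℕ} {t : Finset (ℕ × ℕ)} (ht : IsPseudo n t) :
    (t.biUnion fun p => ({p.1, p.2} : Finset ℕ)).card = t.card * 2 := by
  rw [Finset.card_biUnion, Finset.sum_const_nat (m := 2)]
  rotate_left
  · intro p hp q hq hpq
    have := ht.2 p hp q hq hpq
    simp only [Function.onFun, Finset.disjoint_left, Finset.mem_insert, Finset.mem_singleton]
    omega
  · intro p hp
    have := ht.1 p hp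
    exact Finset.card_pair (by omega)

theorem exists_free {n : ℕ} (hn : Even n) {t : Finset (ℕ × ℕ)} (ht : IsPseudo n t)
    {k : ℕ} (hk1 : 1 ≤ k) (hkn : k ≤ n) (hk : ∀ p ∈ t, p.1 ≠ k ∧ p.2 ≠ k) :
    ∃ m, 1 ≤ m ∧ m ≤ n ∧ m ≠ k ∧ ∀ p ∈ t, p.1 ≠ m ∧ p.2 ≠ m := by
  by_contra hcon
  have heq : (t.biUnion fun p => ({p.1, p.2} : Finset ℕ)) = (Finset.Icc 1 n).erase k := by
    ext m
    simp only [Finset.mem_biUnion, Finset.mem_insert, Finset.mem_singleton, Finset.mem_erase,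
      Finset.mem_Icc]
    constructor
    · rintro ⟨p, hp, h⟩
      have := ht.1 p hp
      have := hk p hp
      omega
    · rintro ⟨h1, h2, h3⟩
      by_contra h
      refine hcon ⟨m, h2, h3, h1, fun p hp => ⟨fun e => h ⟨p, hp, Or.inl e.symm⟩,
        fun e => h ⟨p, hp, Or.inr e.symm⟩⟩⟩
  have h1 := card_paired ht
  rw [heq, Finset.card_erase_of_mem (by simp; omega), Nat.card_Icc] at h1
  obtain ⟨r, hr⟩ := hn
  omega

theorem dg_ext_le {n : ℕ} (hn : Even n) {t : Finset (ℕ × ℕ)} (ht : IsPseudo n t)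
    {k : ℕ} (hk1 : 1 ≤ k) (hkn : k ≤ n) (hk : ∀ p ∈ t, p.1 ≠ k ∧ p.2 ≠ k) :
    dg (n + 1) (insert (k, n + 1) t) ≤ dg n t := by
  obtain ⟨e, he1, he2, he3, hek, het⟩ : ∃ e : ℕ × ℕ, 1 ≤ e.1 ∧ e.1 < e.2 ∧ e.2 ≤ n ∧
      (e.1 = k ∨ e.2 = k) ∧
      ∀ p ∈ t, p.1 ≠ e.1 ∧ p.1 ≠ e.2 ∧ p.2 ≠ e.1 ∧ p.2 ≠ e.2 := by
    obtain ⟨m, hm1, hmn, hmk, hm⟩ := exists_free hn ht hk1 hkn hk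
    rcases lt_or_gt_of_ne hmk with h | h
    · exact ⟨(m, k), hm1, h, hkn, Or.inr rfl, fun p hp =>
        ⟨(hm p hp).1, (hk p hp).1, (hm p hp).2, (hk p hp).2⟩⟩
    · exact ⟨(k, m), hk1, h, hmn, Or.inl rfl, fun p hp =>
        ⟨(hk p hp).1, (hm p hp).1, (hk p hp).2, (hm p hp).2⟩⟩
  have hKt : (k, n + 1) ∉ t := fun h => (hk _ h).1 rfl
  have het' : e ∉ t := fun h => (het _ h).1 rfl
  have hout : ∀ w, Neighbor (insert (k, n + 1) t) w → (k, n + 1) ∉ w → w = t := by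
    rintro w (⟨p, hp, rfl⟩ | ⟨p, hp, rfl⟩) hw
    · simp at hw
    · have : p = (k, n + 1) := by
        by_contra h
        exact hw (by simp [Ne.symm h])
      subst this
      exact Finset.erase_insert hKt
  have hclash : ∀ w, IsPseudo (n + 1) w → (k, n + 1) ∈ w → e ∉ w := by
    intro w hw h1 h2
    have := hw.2 _ h1 _ h2 (by rintro rfl; simp at he3)
    simp only at this
    omega
  classical
  apply Set.ncard_le_ncard_of_injOn
    (fun w => if (k, n + 1) ∈ w then w.erase (k, n + 1) else insert e t) (ht := pseudo_finite _ _)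
  · rintro w ⟨hw, hnw⟩
    by_cases h : (k, n + 1) ∈ w
    · simp only [h, if_true]
      refine ⟨⟨?_, ?_⟩, ?_⟩
      · intro p hp
        obtain ⟨hp1, hp2⟩ := Finset.mem_erase.1 hp
        have a := hw.1 p hp2
        have b := hw.2 p hp2 _ h hp1
        simp only at b
        omega
      · intro p hp q hq
        exact hw.2 p (Finset.mem_of_mem_erase hp) q (Finset.mem_of_mem_erase hq)
      · rcases hnw with ⟨p, hp, rfl⟩ | ⟨p, hp, rfl⟩
        · simp only [Finset.mem_insert, not_or] at hp
          refine Or.inl ⟨p, hp.2, ?_⟩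
          rw [Finset.erase_insert_of_ne hp.1, Finset.erase_insert hKt]
        · have hpK : p ≠ (k, n + 1) := by
            rintro rfl
            simp at h
          refine Or.inr ⟨p, (Finset.mem_insert.1 hp).resolve_left hpK, ?_⟩
          rw [Finset.erase_right_comm, Finset.erase_insert hKt]
    · simp only [h, if_false]
      refine ⟨⟨?_, ?_⟩, Or.inl ⟨e, het', rfl⟩⟩
      · intro p hp
        rcases Finset.mem_insert.1 hp with rfl | hp
        · exact ⟨he1, he2, he3⟩
        · exact ht.1 p hp
      · intro p hp q hq hpq
        rcases Finset.mem_insert.1 hp with rfl | hp2 <;>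
          rcases Finset.mem_insert.1 hq with rfl | hq2
        · exact absurd rfl hpq
        · have := het q hq2
          omega
        · have := het p hp2
          omega
        · exact ht.2 p hp2 q hq2 hpq
  · rintro v ⟨hv, hnv⟩ w ⟨hw, hnw⟩ hvw
    by_cases h1 : (k, n + 1) ∈ v <;> by_cases h2 : (k, n + 1) ∈ w <;>
      simp only [h1, h2, if_true, if_false] at hvw
    · rw [← Finset.insert_erase h1, hvw, Finset.insert_erase h2]
    · exact absurd (Finset.mem_of_mem_erase (hvw ▸ Finset.mem_insert_self e t)) (hclash v hv h1)
    · exact absurd (Finset.mem_of_mem_erase (hvw ▸ Finset.mem_insert_self e t)) (hclash w hw h2)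
    · rw [hout v hnv h1, hout w hnw h2]

theorem stmt_13 (n : ℕ) (hn : Even n) (s t s' t' : Finset (ℕ × ℕ))
    (hs : IsPseudo n s) (ht : IsPseudo n t) (hst : dg n s ≥ dg n t)
    (hs' : IsPseudo (n + 1) s') (ht' : IsPseudo (n + 1) t')
    (hes : ExtendsTo n s s') (het : ExtendsTo n t t')
    (hcs : s'.card = s.card) (hct : t'.card = t.card + 1) :
    dg (n + 1) s' ≥ dg (n + 1) t' := by
  have h1 : s' = s := by
    rcases hes with h | ⟨k, hk1, hkn, hk, rfl⟩
    · exact h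
    · rw [Finset.card_insert_of_notMem (fun h => (hk _ h).1 rfl)] at hcs
      omega
  subst h1
  rcases het with rfl | ⟨k, hk1, hkn, hk, rfl⟩
  · omega
  · exact (dg_ext_le hn ht hk1 hkn hk).trans (le_trans hst (dg_mono n _))
end

section
/- Let n ≥ 2 be even. Then the number of elements of Succ_n is at least Σ_{k=0}^{n/2} Σ_{ℓ=k}^{n/2} [C(n,2k)·(2k)!/(k!·2^k)]·[C(n,2ℓ)·(2ℓ)!/(ℓ!·2^ℓ) − 1] + Σ_{k=0}^{n/2−2} Σ_{ℓ=k}^{n/2−1} [C(n,2k)·(2k)!/(k!·2^k)]·[C(n,2ℓ)·(2ℓ)!/(ℓ!·2^ℓ) − 1]·(n−2ℓ) + Σ_{k=0}^{n/2−1} Σ_{ℓ=k+1}^{n/2} [C(n,2k)·(2k)!/(k!·2^k)]·[C(n,2ℓ)·(2ℓ)!/(ℓ!·2^ℓ)]·(n−2k) + Σ_{k=0}^{n/2−1} Σ_{ℓ=k}^{n/2−1} [C(n,2k)·(2k)!/(k!·2^k)]·[C(n,2ℓ)·(2ℓ)!/(ℓ!·2^ℓ) − 1]·(n−2k)(n−2ℓ).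 -/
/-- `Fail n`: the set of 4-tuples `(s, t, s', t')` where `s ≠ t` are
pseudo-secondary structures on `n` positions with `dg s ≥ dg t`, and
`s'`, `t'` are pseudo-secondary structures on `n+1` positions with
`s ≺ s'`, `t ≺ t'`, but `dg s' < dg t'`. -/
def FailSet (n : ℕ) :
    Set (Finset (ℕ × ℕ) × Finset (ℕ × ℕ) × Finset (ℕ × ℕ) × Finset (ℕ × ℕ)) :=
  {x | IsPseudo n x.1 ∧ IsPseudo n x.2.1 ∧ x.1 ≠ x.2.1 ∧
    dg n x.1 ≥ dg n x.2.1 ∧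
    IsPseudo (n + 1) x.2.2.1 ∧ IsPseudo (n + 1) x.2.2.2 ∧
    ExtendsTo n x.1 x.2.2.1 ∧ ExtendsTo n x.2.1 x.2.2.2 ∧
    dg (n + 1) x.2.2.1 < dg (n + 1) x.2.2.2}

/-- `Succ n`: the set of 4-tuples `(s, t, s', t')` where `s ≠ t` are
pseudo-secondary structures on `n` positions with `dg s ≥ dg t`, and
`s'`, `t'` are pseudo-secondary structures on `n+1` positions with
`s ≺ s'`, `t ≺ t'`, and `dg s' ≥ dg t'`. -/
def SuccSet (n : ℕ) :
    Set (Finset (ℕ × ℕ) × Finset (ℕ × ℕ) × Finset (ℕ × ℕ) × Finset (ℕ × ℕ)) :=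
  {x | IsPseudo n x.1 ∧ IsPseudo n x.2.1 ∧ x.1 ≠ x.2.1 ∧
    dg n x.1 ≥ dg n x.2.1 ∧
    IsPseudo (n + 1) x.2.2.1 ∧ IsPseudo (n + 1) x.2.2.2 ∧
    ExtendsTo n x.1 x.2.2.1 ∧ ExtendsTo n x.2.1 x.2.2.2 ∧
    dg (n + 1) x.2.2.1 ≥ dg (n + 1) x.2.2.2}

/-- `C(n, 2k) · (2k)! / (k! · 2^k)`, the number of pseudo-secondary structures
on `n` positions having exactly `k` pairs. -/
def mcount (n k : ℕ) : ℕ :=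
  n.choose (2 * k) * ((2 * k).factorial / (k.factorial * 2 ^ k))

namespace PseudoAux

open Finset

abbrev FS := Finset (ℕ × ℕ)

def supp (s : FS) : Finset ℕ := s.biUnion (fun p => {p.1, p.2})

def unp (n : ℕ) (s : FS) : Finset ℕ := Finset.Icc 1 n \ supp s

lemma mem_supp {s : FS} {a : ℕ} : a ∈ supp s ↔ ∃ p ∈ s, a = p.1 ∨ a = p.2 := by
  simp [supp]

lemma mem_unp {n : ℕ} {s : FS} {a : ℕ} :
    a ∈ unp n s ↔ (1 ≤ a ∧ a ≤ n) ∧ ∀ p ∈ s, p.1 ≠ a ∧ p.2 ≠ a := by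
  simp only [unp, mem_sdiff, mem_supp, Finset.mem_Icc, not_exists, not_and, not_or]
  constructor
  · rintro ⟨h, h'⟩
    exact ⟨h, fun p hp => ⟨fun e => (h' p hp).1 e.symm, fun e => (h' p hp).2 e.symm⟩⟩
  · rintro ⟨h, h'⟩
    exact ⟨h, fun p hp => ⟨fun e => (h' p hp).1 e.symm, fun e => (h' p hp).2 e.symm⟩⟩

lemma card_supp {n : ℕ} {s : FS} (h : IsPseudo n s) : (supp s).card = 2 * s.card := by
  unfold supp
  rw [card_biUnion]
  · rw [Finset.sum_congr rfl (g := fun _ => 2)]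
    · simp [mul_comm]
    · intro p hp
      exact Finset.card_pair (h.1 p hp).2.1.ne
  · intro p hp q hq hpq
    have := h.2 p hp q hq hpq
    rw [Function.onFun, Finset.disjoint_left]
    intro a ha hb
    simp only [Finset.mem_insert, Finset.mem_singleton] at ha hb
    grind

lemma supp_subset {n : ℕ} {s : FS} (h : IsPseudo n s) : supp s ⊆ Finset.Icc 1 n := by
  intro a ha
  obtain ⟨p, hp, h'⟩ := mem_supp.1 ha
  have := h.1 p hp
  rw [Finset.mem_Icc]
  omega

lemma card_unp {n : ℕ} {s : FS} (h : IsPseudo n s) : (unp n s).card = n - 2 * s.card := by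
  unfold unp
  rw [card_sdiff_of_subset (supp_subset h), card_supp h]
  simp

lemma two_card_le {n : ℕ} {s : FS} (h : IsPseudo n s) : 2 * s.card ≤ n := by
  have := card_le_card (supp_subset h)
  rw [card_supp h] at this
  simpa using this

lemma pseudo_mono {n : ℕ} {s : FS} (h : IsPseudo n s) : IsPseudo (n + 1) s :=
  ⟨fun p hp => by have := h.1 p hp; omega, h.2⟩

lemma pseudo_insert {n : ℕ} {s : FS} (h : IsPseudo n s) {i j : ℕ} (hi : i ∈ unp n s)
    (hj : j ∈ unp n s) (hij : i < j) : IsPseudo n (insert (i, j) s) := by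
  rw [mem_unp] at hi hj
  constructor
  · intro p hp
    rw [Finset.mem_insert] at hp
    rcases hp with rfl | hp
    · exact ⟨hi.1.1, hij, hj.1.2⟩
    · exact h.1 p hp
  · intro p hp q hq hpq
    rw [Finset.mem_insert] at hp hq
    rcases hp with rfl | hp
    · rcases hq with rfl | hq
      · exact absurd rfl hpq
      · have := hi.2 q hq
        have := hj.2 q hq
        grind
    · rcases hq with rfl | hq
      · have := hi.2 p hp
        have := hj.2 p hp
        grind
      · exact h.2 p hp q hq hpq

/-- pairs of unpaired positions -/
def prs (U : Finset ℕ) : FS := (U ×ˢ U).filter (fun p => p.1 < p.2)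

lemma card_prs (U : Finset ℕ) : 2 * (prs U).card + U.card = U.card * U.card := by
  have h1 : (prs U).card = ((U ×ˢ U).filter (fun p => p.2 < p.1)).card := by
    apply Finset.card_bij (fun p _ => (p.2, p.1))
    · intro p hp
      simp [prs] at hp ⊢
      tauto
    · rintro ⟨a, b⟩ _ ⟨c, d⟩ _ h
      simp at h ⊢
      tauto
    · rintro ⟨a, b⟩ h
      refine ⟨(b, a), ?_, rfl⟩
      simp [prs] at h ⊢
      tauto
  have h2 : U.card = ((U ×ˢ U).filter (fun p => p.1 = p.2)).card := by
    apply Finset.card_bij (fun a _ => (a, a))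
    · intro p hp
      simpa using hp
    · intro a _ b _ h
      simpa using h
    · rintro ⟨a, b⟩ h
      simp at h
      exact ⟨a, h.1.1, by simp [h.2]⟩
  have h3 : (U ×ˢ U) = prs U ∪ ((U ×ˢ U).filter (fun p => p.2 < p.1) ∪
      (U ×ˢ U).filter (fun p => p.1 = p.2)) := by
    ext ⟨a, b⟩
    simp [prs]
    have := lt_trichotomy a b
    tauto
  have h4 : (U ×ˢ U).card = (prs U).card + (((U ×ˢ U).filter (fun p => p.2 < p.1)).card +
      ((U ×ˢ U).filter (fun p => p.1 = p.2)).card) := by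
    conv_lhs => rw [h3]
    rw [card_union_of_disjoint, card_union_of_disjoint]
    · rw [Finset.disjoint_left]
      intro p h h'
      simp at h h'
      omega
    · rw [Finset.disjoint_left]
      intro p h h'
      simp [prs] at h h'
      omega
  rw [card_product] at h4
  omega

lemma dg_eq {n : ℕ} {s : FS} (h : IsPseudo n s) :
    dg n s = s.card + (prs (unp n s)).card := by
  have hset : {t : FS | IsPseudo n t ∧ Neighbor s t} =
      ((s.image (fun p => s.erase p) ∪ (prs (unp n s)).image (fun p => insert p s) : Finset FS) :
        Set FS) := by
    ext t
    simp only [Set.mem_ofPred_eq, Finset.coe_union, Finset.coe_image, Set.mem_union, Set.mem_image,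
      Finset.mem_coe, Neighbor]
    constructor
    · rintro ⟨ht, ⟨p, hp, rfl⟩ | ⟨p, hp, rfl⟩⟩
      · right
        refine ⟨p, ?_, rfl⟩
        have hp1 := ht.1 p (Finset.mem_insert_self _ _)
        have hp2 : ∀ q ∈ s, _ := fun q hq => ht.2 p (Finset.mem_insert_self _ _) q
          (Finset.mem_insert_of_mem hq) (fun e => hp (e ▸ hq))
        simp only [prs, Finset.mem_filter, Finset.mem_product, mem_unp]
        grind
      · left
        exact ⟨p, hp, rfl⟩
    · rintro (⟨p, hp, rfl⟩ | ⟨p, hp, rfl⟩)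
      · refine ⟨⟨fun q hq => h.1 q (Finset.mem_of_mem_erase hq), fun q hq r hr =>
          h.2 q (Finset.mem_of_mem_erase hq) r (Finset.mem_of_mem_erase hr)⟩, Or.inr ⟨p, hp, rfl⟩⟩
      · simp only [prs, Finset.mem_filter, Finset.mem_product] at hp
        refine ⟨pseudo_insert h hp.1.1 hp.1.2 hp.2, Or.inl ⟨p, ?_, rfl⟩⟩
        intro hps
        exact ((mem_unp.1 hp.1.1).2 p hps).1 rfl
  have hnot : ∀ p ∈ prs (unp n s), p ∉ s := by
    intro p hp hps
    simp only [prs, Finset.mem_filter, Finset.mem_product] at hp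
    exact ((mem_unp.1 hp.1.1).2 p hps).1 rfl
  unfold dg
  rw [hset, Set.ncard_coe_finset, card_union_of_disjoint, card_image_of_injOn, card_image_of_injOn]
  · intro p hp q hq hpq
    have h1 : p ∈ insert q s := by
      have : p ∈ insert p s := Finset.mem_insert_self _ _
      simp only at hpq
      rwa [hpq] at this
    rw [Finset.mem_insert] at h1
    exact h1.resolve_right (hnot p hp)
  · intro p hp q hq hpq
    by_contra hne
    have h1 : p ∈ s.erase q := Finset.mem_erase.2 ⟨hne, hp⟩
    simp only at hpq
    rw [← hpq] at h1
    exact (Finset.notMem_erase p s) h1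
  · rw [Finset.disjoint_left]
    intro t ht ht'
    rw [Finset.mem_image] at ht ht'
    obtain ⟨p, hp, rfl⟩ := ht
    obtain ⟨q, hq, e⟩ := ht'
    have : p ∈ insert q s := Finset.mem_insert_of_mem hp
    rw [e] at this
    exact (Finset.notMem_erase p s) this

lemma dg_mono {n : ℕ} {s t : FS} (hs : IsPseudo n s) (ht : IsPseudo n t)
    (hst : s.card ≤ t.card) : dg n t ≤ dg n s := by
  rw [dg_eq hs, dg_eq ht]
  have h1 := card_prs (unp n s)
  have h2 := card_prs (unp n t)
  rw [card_unp hs] at h1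
  rw [card_unp ht] at h2
  have h3 := two_card_le ht
  obtain ⟨d, hd⟩ := Nat.exists_eq_add_of_le hst
  obtain ⟨u, hu⟩ := Nat.exists_eq_add_of_le h3
  have e1 : n - 2 * s.card = u + 2 * d := by omega
  have e2 : n - 2 * t.card = u := by omega
  rw [e1] at h1
  rw [e2] at h2
  rw [hd]
  have : d ≤ d * d := Nat.le_mul_self d
  nlinarith [Nat.zero_le (d * u)]

/-- the nontrivial extensions -/
def ext (n : ℕ) (s : FS) : Finset FS := (unp n s).image (fun k => insert (k, n + 1) s)

lemma not_mem_last {n : ℕ} {s : FS} (h : IsPseudo n s) (k : ℕ) : (k, n + 1) ∉ s := by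
  intro hk
  have := (h.1 _ hk).2.2
  simp at this

lemma ext_inj {n : ℕ} {s t : FS} (hs : IsPseudo n s) (ht : IsPseudo n t) {i j : ℕ}
    (h : insert (i, n + 1) s = insert (j, n + 1) t) : s = t ∧ i = j := by
  have h1 : (i, n + 1) ∈ insert (j, n + 1) t := h ▸ Finset.mem_insert_self _ _
  rw [Finset.mem_insert] at h1
  have h2 := h1.resolve_right (not_mem_last ht i)
  have h3 : i = j := by simpa using h2
  subst h3
  refine ⟨?_, rfl⟩
  rw [← Finset.erase_insert (not_mem_last hs i), h, Finset.erase_insert (not_mem_last ht i)]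

lemma card_ext {n : ℕ} {s : FS} (h : IsPseudo n s) : (ext n s).card = n - 2 * s.card := by
  unfold ext
  rw [card_image_of_injOn, card_unp h]
  intro i _ j _ hij
  exact (ext_inj h h hij).2

lemma ext_spec {n : ℕ} {s s' : FS} (h : IsPseudo n s) (h' : s' ∈ ext n s) :
    IsPseudo (n + 1) s' ∧ s'.card = s.card + 1 ∧ ExtendsTo n s s' ∧ s' ≠ s := by
  unfold ext at h'
  rw [Finset.mem_image] at h'
  obtain ⟨k, hk, rfl⟩ := h'
  have hk' := mem_unp.1 hk
  refine ⟨?_, ?_, ?_, ?_⟩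
  · apply pseudo_insert (pseudo_mono h)
    · rw [mem_unp]
      exact ⟨by omega, hk'.2⟩
    · rw [mem_unp]
      refine ⟨by omega, fun p hp => ?_⟩
      have := h.1 p hp
      omega
    · omega
  · rw [Finset.card_insert_of_notMem (not_mem_last h k)]
  · exact Or.inr ⟨k, hk'.1.1, hk'.1.2, hk'.2, rfl⟩
  · intro e
    exact not_mem_last h k (e ▸ Finset.mem_insert_self _ _)

open Classical in
noncomputable def Mt (n : ℕ) : Finset FS :=
  ((Finset.Icc 1 n ×ˢ Finset.Icc 1 n).powerset).filter (fun s => IsPseudo n s)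

lemma mem_Mt {n : ℕ} {s : FS} : s ∈ Mt n ↔ IsPseudo n s := by
  classical
  unfold Mt
  rw [Finset.mem_filter, Finset.mem_powerset]
  refine ⟨fun h => h.2, fun h => ⟨fun p hp => ?_, h⟩⟩
  have := h.1 p hp
  rw [Finset.mem_product, Finset.mem_Icc, Finset.mem_Icc]
  omega

noncomputable def Mk (n k : ℕ) : Finset FS := (Mt n).filter (fun s => s.card = k)

lemma mem_Mk {n k : ℕ} {s : FS} : s ∈ Mk n k ↔ IsPseudo n s ∧ s.card = k := by
  unfold Mk
  rw [Finset.mem_filter, mem_Mt]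

lemma Mk_rec (n k : ℕ) :
    (Mk n (k + 1)).card + (Mk n k).card * (n - 2 * k) ≤ (Mk (n + 1) (k + 1)).card := by
  have h1 : ((Mk n k).biUnion (ext n)).card = (Mk n k).card * (n - 2 * k) := by
    rw [card_biUnion, Finset.sum_const_nat]
    · intro s hs
      rw [mem_Mk] at hs
      rw [card_ext hs.1, hs.2]
    · intro s hs t ht hst
      have hs := (mem_Mk.1 hs).1
      have ht := (mem_Mk.1 ht).1
      rw [Function.onFun, Finset.disjoint_left]
      intro x hx hy
      simp only [ext, Finset.mem_image] at hx hy
      obtain ⟨i, _, rfl⟩ := hx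
      obtain ⟨j, _, e⟩ := hy
      exact hst (ext_inj ht hs e).1.symm
  rw [← h1, ← card_union_of_disjoint]
  · apply card_le_card
    intro x hx
    rw [Finset.mem_union, Finset.mem_biUnion] at hx
    rw [mem_Mk]
    rcases hx with hx | ⟨s, hs, hx⟩
    · rw [mem_Mk] at hx
      exact ⟨pseudo_mono hx.1, hx.2⟩
    · rw [mem_Mk] at hs
      have := ext_spec hs.1 hx
      exact ⟨this.1, by rw [this.2.1, hs.2]⟩
  · rw [Finset.disjoint_left]
    intro x hx hy
    rw [Finset.mem_biUnion] at hy
    obtain ⟨s, hs, hy⟩ := hy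
    simp only [ext, Finset.mem_image] at hy
    obtain ⟨j, _, rfl⟩ := hy
    exact not_mem_last (mem_Mk.1 hx).1 j (Finset.mem_insert_self _ _)

lemma fact_dvd (k : ℕ) : k.factorial * 2 ^ k ∣ (2 * k).factorial := by
  rw [mul_comm, ← Nat.doubleFactorial_two_mul]
  cases k with
  | zero => simp
  | succ k =>
    rw [show 2 * (k + 1) = (2 * k + 1) + 1 by ring, Nat.factorial_eq_mul_doubleFactorial]
    exact Dvd.intro _ rfl

lemma mcount_mul (n k : ℕ) : mcount n k * (k.factorial * 2 ^ k) = n.descFactorial (2 * k) := by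
  unfold mcount
  rw [mul_assoc, Nat.div_mul_cancel (fact_dvd k), Nat.descFactorial_eq_factorial_mul_choose,
    mul_comm]

lemma descRec (n k : ℕ) : (n + 1).descFactorial (k + 1) =
    n.descFactorial (k + 1) + (k + 1) * n.descFactorial k := by
  rw [Nat.succ_descFactorial_succ, Nat.descFactorial_succ]
  rcases le_or_gt k n with h | h
  · obtain ⟨d, rfl⟩ := Nat.exists_eq_add_of_le h
    rw [Nat.add_sub_cancel_left]
    ring
  · rw [Nat.descFactorial_eq_zero_iff_lt.2 h]
    simp

lemma mcount_rec (n k : ℕ) :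
    mcount (n + 1) (k + 1) = mcount n (k + 1) + mcount n k * (n - 2 * k) := by
  have hpos : 0 < (k + 1).factorial * 2 ^ (k + 1) := by positivity
  apply Nat.eq_of_mul_eq_mul_right hpos
  rw [add_mul, mcount_mul, mcount_mul]
  have e : mcount n k * (n - 2 * k) * ((k + 1).factorial * 2 ^ (k + 1)) =
      (2 * k + 2) * ((n - 2 * k) * (mcount n k * (k.factorial * 2 ^ k))) := by
    rw [Nat.factorial_succ]
    ring
  rw [e, mcount_mul, ← Nat.descFactorial_succ]
  exact descRec n (2 * k + 1)

lemma mcount_le (n k : ℕ) : mcount n k ≤ (Mk n k).card := by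
  have h0 : ∀ n, mcount n 0 ≤ (Mk n 0).card := by
    intro n
    have : mcount n 0 = 1 := by simp [mcount]
    rw [this, Nat.succ_le_iff, Finset.card_pos]
    exact ⟨∅, mem_Mk.2 ⟨⟨by simp, by simp⟩, rfl⟩⟩
  induction n generalizing k with
  | zero =>
    cases k with
    | zero => exact h0 0
    | succ k => simp [mcount, Nat.mul_succ]
  | succ n ih =>
    cases k with
    | zero => exact h0 _
    | succ k =>
      rw [mcount_rec]
      refine le_trans ?_ (Mk_rec n k)
      exact Nat.add_le_add (ih _) (Nat.mul_le_mul_right _ (ih _))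

lemma gen (n : ℕ) (W : Finset (FS × FS × FS × FS)) (A : Finset ℕ) (B : ℕ → Finset ℕ)
    (X Y : FS → Finset FS) (c : ℕ → ℕ → ℕ) (cx cy : ℕ → ℕ)
    (hX : ∀ s, IsPseudo n s → (X s).card = cx s.card)
    (hY : ∀ s, IsPseudo n s → (Y s).card = cy s.card)
    (hc : ∀ k ∈ A, ∀ l ∈ B k, ∀ s ∈ Mk n k, c k l ≤ ((Mk n l).erase s).card)
    (hW : ∀ s t x y, IsPseudo n s → IsPseudo n t → s ≠ t → s.card ∈ A → t.card ∈ B s.card →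
      x ∈ X s → y ∈ Y t → (s, t, x, y) ∈ W) :
    ∑ k ∈ A, ∑ l ∈ B k, mcount n k * c k l * (cx k * cy l) ≤ W.card := by
  have step : ∑ k ∈ A, ∑ l ∈ B k, mcount n k * c k l * (cx k * cy l) ≤
      ∑ k ∈ A, ∑ l ∈ B k, ∑ s ∈ Mk n k, ∑ t ∈ (Mk n l).erase s, (X s ×ˢ Y t).card := by
    refine Finset.sum_le_sum fun k hk => Finset.sum_le_sum fun l hl => ?_
    calc mcount n k * c k l * (cx k * cy l)
        ≤ (Mk n k).card * (c k l * (cx k * cy l)) := by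
          rw [mul_assoc]
          exact Nat.mul_le_mul_right _ (mcount_le n k)
      _ = ∑ s ∈ Mk n k, c k l * (cx k * cy l) := by simp
      _ ≤ _ := by
          refine Finset.sum_le_sum fun s hs => ?_
          calc c k l * (cx k * cy l) ≤ ((Mk n l).erase s).card * (cx k * cy l) :=
                Nat.mul_le_mul_right _ (hc k hk l hl s hs)
            _ = ∑ t ∈ (Mk n l).erase s, (cx k * cy l) := by simp
            _ ≤ _ := by
                refine Finset.sum_le_sum fun t ht => le_of_eq ?_
                rw [mem_Mk] at hs
                have ht := mem_Mk.1 (Finset.mem_of_mem_erase ht)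
                rw [card_product, hX s hs.1, hY t ht.1, hs.2, ht.2]
  refine step.trans ?_
  have e : ∑ k ∈ A, ∑ l ∈ B k, ∑ s ∈ Mk n k, ∑ t ∈ (Mk n l).erase s, (X s ×ˢ Y t).card =
      (A.sigma fun k => (B k).sigma fun l => (Mk n k).sigma fun s =>
        ((Mk n l).erase s).sigma fun t => X s ×ˢ Y t).card := by
    simp only [Finset.card_sigma]
  rw [e]
  apply Finset.card_le_card_of_injOn
    (fun z => (z.2.2.1, z.2.2.2.1, z.2.2.2.2.1, z.2.2.2.2.2))
  · rintro ⟨k, l, s, t, x, y⟩ hz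
    simp only [Finset.mem_coe, Finset.mem_sigma, Finset.mem_product, Finset.mem_erase, mem_Mk] at hz ⊢
    obtain ⟨hk, hl, ⟨hs, rfl⟩, ⟨hne, ht, rfl⟩, hx, hy⟩ := hz
    exact hW s t x y hs ht (Ne.symm hne) hk hl hx hy
  · rintro ⟨k, l, s, t, x, y⟩ hz ⟨k', l', s', t', x', y'⟩ hz' h
    simp only [Finset.mem_coe, Finset.mem_sigma, Finset.mem_product, Finset.mem_erase, mem_Mk] at hz hz'
    obtain ⟨-, -, ⟨-, rfl⟩, ⟨-, -, rfl⟩, -⟩ := hz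
    obtain ⟨-, -, ⟨-, rfl⟩, ⟨-, -, rfl⟩, -⟩ := hz'
    simp only [Prod.mk.injEq] at h
    obtain ⟨rfl, rfl, rfl, rfl⟩ := h
    rfl

open Classical in
noncomputable def SW (n : ℕ) : Finset (FS × FS × FS × FS) :=
  (Mt n ×ˢ Mt n ×ˢ Mt (n + 1) ×ˢ Mt (n + 1)).filter (fun x => x ∈ SuccSet n)

lemma mem_SW {n : ℕ} {x} : x ∈ SW n ↔ x ∈ SuccSet n := by
  classical
  unfold SW
  rw [Finset.mem_filter]
  refine ⟨fun h => h.2, fun h => ⟨?_, h⟩⟩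
  simp only [Finset.mem_product, mem_Mt]
  exact ⟨h.1, h.2.1, h.2.2.2.2.1, h.2.2.2.2.2.1⟩

lemma mem_of {n : ℕ} {s t x y : FS} (hs : IsPseudo n s) (ht : IsPseudo n t) (hne : s ≠ t)
    (hc : s.card ≤ t.card) (hx : IsPseudo (n + 1) x) (hy : IsPseudo (n + 1) y)
    (hxs : ExtendsTo n s x) (hyt : ExtendsTo n t y) (hc' : x.card ≤ y.card) :
    (s, t, x, y) ∈ SW n :=
  mem_SW.2 ⟨hs, ht, hne, dg_mono hs ht hc, hx, hy, hxs, hyt, dg_mono hx hy hc'⟩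

lemma erase_bound (n l : ℕ) (s : FS) : mcount n l - 1 ≤ ((Mk n l).erase s).card :=
  (Nat.sub_le_sub_right (mcount_le n l) 1).trans Finset.pred_card_le_card_erase

lemma erase_bound' {n k l : ℕ} (h : k < l) {s : FS} (hs : s ∈ Mk n k) :
    mcount n l ≤ ((Mk n l).erase s).card := by
  rw [Finset.erase_eq_of_notMem]
  · exact mcount_le n l
  · intro h'
    have h1 := (mem_Mk.1 hs).2
    have h2 := (mem_Mk.1 h').2
    omega

end PseudoAux

open PseudoAux in
theorem stmt_18 (n : ℕ) (hn : Even n) (h2 : 2 ≤ n) :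
    Set.ncard (SuccSet n) ≥
      (∑ k ∈ Finset.Icc 0 (n / 2), ∑ l ∈ Finset.Icc k (n / 2),
        mcount n k * (mcount n l - 1)) +
      (∑ k ∈ Finset.Icc 0 (n / 2 - 2), ∑ l ∈ Finset.Icc k (n / 2 - 1),
        mcount n k * (mcount n l - 1) * (n - 2 * l)) +
      (∑ k ∈ Finset.Icc 0 (n / 2 - 1), ∑ l ∈ Finset.Icc (k + 1) (n / 2),
        mcount n k * mcount n l * (n - 2 * k)) +
      (∑ k ∈ Finset.Icc 0 (n / 2 - 1), ∑ l ∈ Finset.Icc k (n / 2 - 1),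
        mcount n k * (mcount n l - 1) * ((n - 2 * k) * (n - 2 * l))) := by
  classical
  have hfin : (SuccSet n) = ((SW n : Finset _) : Set _) := by
    ext x
    rw [Finset.mem_coe, mem_SW]
  rw [hfin, Set.ncard_coe_finset]
  have b1 := gen n ((SW n).filter fun x => x.2.2.1 = x.1 ∧ x.2.2.2 = x.2.1)
    (Finset.Icc 0 (n / 2)) (fun k => Finset.Icc k (n / 2)) (fun s => {s}) (fun s => {s})
    (fun _ l => mcount n l - 1) (fun _ => 1) (fun _ => 1) (by simp) (by simp)
    (fun k _ l _ s _ => erase_bound n l s) (by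
      intro s t x y hs ht hne hA hB hx hy
      rw [Finset.mem_singleton] at hx hy
      subst hx hy
      rw [Finset.mem_Icc] at hA hB
      rw [Finset.mem_filter]
      exact ⟨mem_of hs ht hne hB.1 (pseudo_mono hs) (pseudo_mono ht) (Or.inl rfl) (Or.inl rfl)
        hB.1, rfl, rfl⟩)
  have b2 := gen n ((SW n).filter fun x => x.2.2.1 = x.1 ∧ x.2.2.2 ≠ x.2.1)
    (Finset.Icc 0 (n / 2 - 2)) (fun k => Finset.Icc k (n / 2 - 1)) (fun s => {s}) (ext n)
    (fun _ l => mcount n l - 1) (fun _ => 1) (fun l => n - 2 * l) (by simp)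
    (fun s hs => card_ext hs)
    (fun k _ l _ s _ => erase_bound n l s) (by
      intro s t x y hs ht hne hA hB hx hy
      rw [Finset.mem_singleton] at hx
      subst hx
      obtain ⟨y1, y2, y3, y4⟩ := ext_spec ht hy
      rw [Finset.mem_Icc] at hA hB
      rw [Finset.mem_filter]
      exact ⟨mem_of hs ht hne hB.1 (pseudo_mono hs) y1 (Or.inl rfl) y3
        (by omega), rfl, y4⟩)
  have b3 := gen n ((SW n).filter fun x => x.2.2.1 ≠ x.1 ∧ x.2.2.2 = x.2.1)
    (Finset.Icc 0 (n / 2 - 1)) (fun k => Finset.Icc (k + 1) (n / 2)) (ext n) (fun s => {s})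
    (fun _ l => mcount n l) (fun k => n - 2 * k) (fun _ => 1) (fun s hs => card_ext hs) (by simp)
    (fun k _ l hl s hs => erase_bound' (Finset.mem_Icc.1 hl).1 hs) (by
      intro s t x y hs ht hne hA hB hx hy
      rw [Finset.mem_singleton] at hy
      subst hy
      obtain ⟨x1, x2, x3, x4⟩ := ext_spec hs hx
      rw [Finset.mem_Icc] at hA hB
      rw [Finset.mem_filter]
      exact ⟨mem_of hs ht hne (by omega) x1 (pseudo_mono ht) x3 (Or.inl rfl)
        (by omega), x4, rfl⟩)
  have b4 := gen n ((SW n).filter fun x => x.2.2.1 ≠ x.1 ∧ x.2.2.2 ≠ x.2.1)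
    (Finset.Icc 0 (n / 2 - 1)) (fun k => Finset.Icc k (n / 2 - 1)) (ext n) (ext n)
    (fun _ l => mcount n l - 1) (fun k => n - 2 * k) (fun l => n - 2 * l)
    (fun s hs => card_ext hs) (fun s hs => card_ext hs)
    (fun k _ l _ s _ => erase_bound n l s) (by
      intro s t x y hs ht hne hA hB hx hy
      obtain ⟨x1, x2, x3, x4⟩ := ext_spec hs hx
      obtain ⟨y1, y2, y3, y4⟩ := ext_spec ht hy
      rw [Finset.mem_Icc] at hA hB
      rw [Finset.mem_filter]
      exact ⟨mem_of hs ht hne hB.1 x1 y1 x3 y3 (by omega), x4, y4⟩)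
  simp only [mul_one, one_mul] at b1 b2 b3 b4
  have p0 := Finset.card_filter_add_card_filter_not (s := SW n) (fun x => x.2.2.1 = x.1)
  have p1 := Finset.card_filter_add_card_filter_not
    (s := (SW n).filter fun x => x.2.2.1 = x.1) (fun x => x.2.2.2 = x.2.1)
  have p2 := Finset.card_filter_add_card_filter_not
    (s := (SW n).filter fun x => ¬ x.2.2.1 = x.1) (fun x => x.2.2.2 = x.2.1)
  simp only [Finset.filter_filter] at p1 p2
  simp only [ne_eq] at b1 b2 b3 b4
  omega
end

section
/- For every even integer n ≥ 4, the number of elements of Succ_n is strictly greater than the number of elements of Fail_n; equivalently, more than half of the 4-tuples (s,t,s',t') with s,t distinct pseudo-secondary structures on n positions satisfying dg(s) ≥ dg(t), s ≺ s', and t ≺ t' satisfy dg(s') ≥ dg(t'). -/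
/-- The positions left unpaired by `s`. -/
def unp (n : ℕ) (s : Finset (ℕ × ℕ)) : Finset ℕ :=
  Finset.Icc 1 n \ (s.image Prod.fst ∪ s.image Prod.snd)

lemma mem_unp {n k : ℕ} {s : Finset (ℕ × ℕ)} :
    k ∈ unp n s ↔ (1 ≤ k ∧ k ≤ n) ∧ ∀ p ∈ s, p.1 ≠ k ∧ p.2 ≠ k := by
  unfold unp
  simp only [Finset.mem_sdiff, Finset.mem_Icc, Finset.mem_union, Finset.mem_image, not_or,
    not_exists, not_and]
  constructor
  · rintro ⟨h, h1, h2⟩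
    exact ⟨h, fun p hp => ⟨h1 p hp, h2 p hp⟩⟩
  · rintro ⟨h, h1⟩
    exact ⟨h, fun p hp => (h1 p hp).1, fun p hp => (h1 p hp).2⟩

lemma card_unp {n : ℕ} {s : Finset (ℕ × ℕ)} (hs : IsPseudo n s) :
    (unp n s).card + 2 * s.card = n := by
  have h1 : (s.image Prod.fst).card = s.card := by
    apply Finset.card_image_of_injOn
    intro p hp q hq h
    by_contra hne
    exact (hs.2 p hp q hq hne).1 h
  have h2 : (s.image Prod.snd).card = s.card := by
    apply Finset.card_image_of_injOn
    intro p hp q hq h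
    by_contra hne
    exact (hs.2 p hp q hq hne).2.2.2 h
  have h3 : Disjoint (s.image Prod.fst) (s.image Prod.snd) := by
    rw [Finset.disjoint_left]
    intro a ha hb
    obtain ⟨p, hp, rfl⟩ := Finset.mem_image.1 ha
    obtain ⟨q, hq, h⟩ := Finset.mem_image.1 hb
    by_cases hne : p = q
    · subst hne
      have := hs.1 p hp
      omega
    · exact (hs.2 p hp q hq hne).2.1 h.symm
  have h4 : s.image Prod.fst ∪ s.image Prod.snd ⊆ Finset.Icc 1 n := by
    intro a ha
    simp only [Finset.mem_union, Finset.mem_image] at ha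
    rw [Finset.mem_Icc]
    rcases ha with ⟨p, hp, rfl⟩ | ⟨p, hp, rfl⟩ <;> have := hs.1 p hp <;> omega
  have h5 := Finset.card_sdiff_add_card_eq_card h4
  rw [Finset.card_union_of_disjoint h3, h1, h2, Nat.card_Icc] at h5
  unfold unp
  omega

lemma card_pairs (U : Finset ℕ) :
    2 * ((U ×ˢ U).filter (fun p => p.1 < p.2)).card + U.card = U.card * U.card := by
  have h := Finset.offDiag_card U
  have h2 : U.offDiag = (U ×ˢ U).filter (fun p => p.1 < p.2) ∪
      (U ×ˢ U).filter (fun p => p.2 < p.1) := by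
    ext p
    simp only [Finset.mem_offDiag, Finset.mem_union, Finset.mem_filter, Finset.mem_product]
    have : p.1 ≠ p.2 ↔ p.1 < p.2 ∨ p.2 < p.1 := by omega
    rw [this]
    tauto
  have h3 : ((U ×ˢ U).filter (fun p => p.2 < p.1)).card =
      ((U ×ˢ U).filter (fun p => p.1 < p.2)).card := by
    apply Finset.card_bij (fun p _ => (p.2, p.1))
    · intro p hp
      simp only [Finset.mem_filter, Finset.mem_product] at hp ⊢
      tauto
    · rintro ⟨a, b⟩ _ ⟨c, d⟩ _ h
      simp only [Prod.mk.injEq] at h ⊢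
      tauto
    · rintro ⟨a, b⟩ hp
      refine ⟨(b, a), ?_, rfl⟩
      simp only [Finset.mem_filter, Finset.mem_product] at hp ⊢
      tauto
  have hd : Disjoint ((U ×ˢ U).filter (fun p => p.1 < p.2))
      ((U ×ˢ U).filter (fun p => p.2 < p.1)) := by
    rw [Finset.disjoint_left]
    intro p h1 h2
    have := (Finset.mem_filter.1 h1).2
    have := (Finset.mem_filter.1 h2).2
    omega
  rw [h2, Finset.card_union_of_disjoint hd, h3] at h
  have : U.card ≤ U.card * U.card := Nat.le_mul_self _
  omega

lemma nb_eq {n : ℕ} {s : Finset (ℕ × ℕ)} (hs : IsPseudo n s) :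
    {t : Finset (ℕ × ℕ) | IsPseudo n t ∧ Neighbor s t} =
      ((((unp n s ×ˢ unp n s).filter (fun p => p.1 < p.2)).image (fun p => insert p s) ∪
        s.image (fun p => s.erase p) : Finset (Finset (ℕ × ℕ))) : Set (Finset (ℕ × ℕ))) := by
  ext t
  simp only [Set.mem_setOf_eq, Finset.coe_union, Finset.coe_image, Set.mem_union, Set.mem_image,
    Finset.mem_coe, Finset.mem_filter, Finset.mem_product, mem_unp]
  constructor
  · rintro ⟨ht, ⟨p, hp, rfl⟩ | ⟨p, hp, rfl⟩⟩
    · left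
      have h1 := ht.1 p (Finset.mem_insert_self _ _)
      have h2 : ∀ q ∈ s, _ := fun q hq =>
        ht.2 q (Finset.mem_insert_of_mem hq) p (Finset.mem_insert_self _ _)
          (fun h => hp (h ▸ hq))
      refine ⟨p, ⟨⟨⟨⟨h1.1, by omega⟩, ?_⟩, ⟨⟨by omega, h1.2.2⟩, ?_⟩⟩, h1.2.1⟩, rfl⟩
      · intro q hq
        exact ⟨(h2 q hq).1, (h2 q hq).2.2.1⟩
      · intro q hq
        exact ⟨(h2 q hq).2.1, (h2 q hq).2.2.2⟩
    · right
      exact ⟨p, hp, rfl⟩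
  · rintro (⟨p, ⟨⟨⟨h1, h2⟩, ⟨h3, h4⟩⟩, h5⟩, rfl⟩ | ⟨p, hp, rfl⟩)
    · refine ⟨⟨?_, ?_⟩, Or.inl ⟨p, fun h => (h2 p h).1 rfl, rfl⟩⟩
      · intro q hq
        rcases Finset.mem_insert.1 hq with rfl | hq
        · exact ⟨h1.1, h5, h3.2⟩
        · exact hs.1 q hq
      · intro q hq r hr hne
        rcases Finset.mem_insert.1 hq with rfl | hq2 <;>
          rcases Finset.mem_insert.1 hr with rfl | hr2
        · exact absurd rfl hne
        · have a := h2 r hr2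
          have b := h4 r hr2
          exact ⟨a.1.symm, a.2.symm, b.1.symm, b.2.symm⟩
        · have a := h2 q hq2
          have b := h4 q hq2
          exact ⟨a.1, b.1, a.2, b.2⟩
        · exact hs.2 q hq2 r hr2 hne
    · refine ⟨⟨?_, ?_⟩, Or.inr ⟨p, hp, rfl⟩⟩
      · intro q hq
        exact hs.1 q (Finset.mem_of_mem_erase hq)
      · intro q hq r hr
        exact hs.2 q (Finset.mem_of_mem_erase hq) r (Finset.mem_of_mem_erase hr)

lemma dg_eq_s19 {n : ℕ} {s : Finset (ℕ × ℕ)} (hs : IsPseudo n s) :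
    2 * dg n s + 2 * (unp n s).card = (unp n s).card * (unp n s).card + n := by
  have hnot : ∀ p ∈ (unp n s ×ˢ unp n s).filter (fun p => p.1 < p.2), p ∉ s := by
    intro p hp hps
    simp only [Finset.mem_filter, Finset.mem_product, mem_unp] at hp
    exact (hp.1.1.2 p hps).1 rfl
  have h1 : (((unp n s ×ˢ unp n s).filter (fun p => p.1 < p.2)).image
      (fun p => insert p s)).card = ((unp n s ×ˢ unp n s).filter (fun p => p.1 < p.2)).card := by
    apply Finset.card_image_of_injOn
    intro p hp q hq h
    have hp' := hnot p hp
    have : p ∈ insert q s := by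
      have h' : insert p s = insert q s := h
      rw [← h']
      exact Finset.mem_insert_self _ _
    rcases Finset.mem_insert.1 this with h | h
    · exact h
    · exact absurd h hp'
  have h2 : (s.image (fun p => s.erase p)).card = s.card := by
    apply Finset.card_image_of_injOn
    intro p hp q hq h
    by_contra hne
    have h' : s.erase p = s.erase q := h
    have : p ∈ s.erase q := Finset.mem_erase.2 ⟨hne, hp⟩
    rw [← h'] at this
    exact Finset.notMem_erase p s this
  have h3 : Disjoint (((unp n s ×ˢ unp n s).filter (fun p => p.1 < p.2)).image
      (fun p => insert p s)) (s.image (fun p => s.erase p)) := by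
    rw [Finset.disjoint_left]
    intro t h1 h2
    obtain ⟨p, hp, rfl⟩ := Finset.mem_image.1 h1
    obtain ⟨q, hq, h⟩ := Finset.mem_image.1 h2
    have h' : s.erase q = insert p s := h
    have : q ∈ s.erase q := by
      rw [h']
      exact Finset.mem_insert_of_mem hq
    exact Finset.notMem_erase q s this
  have h4 := card_pairs (unp n s)
  have h5 := card_unp hs
  unfold dg
  rw [nb_eq hs, Set.ncard_coe_finset, Finset.card_union_of_disjoint h3, h1, h2]
  omega

lemma pseudo_succ {n : ℕ} {s : Finset (ℕ × ℕ)} (hs : IsPseudo n s) : IsPseudo (n + 1) s :=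
  ⟨fun p hp => by have := hs.1 p hp; omega, hs.2⟩

lemma unp_same {n : ℕ} {s : Finset (ℕ × ℕ)} (hs : IsPseudo n s) :
    (unp (n + 1) s).card = (unp n s).card + 1 := by
  have := card_unp hs
  have := card_unp (pseudo_succ hs)
  omega

lemma notMem_top {n k : ℕ} {s : Finset (ℕ × ℕ)} (hs : IsPseudo n s) : (k, n + 1) ∉ s := by
  intro h
  have := hs.1 _ h
  simp at this

lemma unp_insert {n k : ℕ} {s : Finset (ℕ × ℕ)} (hs : IsPseudo n s)
    (hs' : IsPseudo (n + 1) (insert (k, n + 1) s)) :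
    (unp (n + 1) (insert (k, n + 1) s)).card + 1 = (unp n s).card := by
  have h1 := card_unp hs
  have h2 := card_unp hs'
  rw [Finset.card_insert_of_notMem (notMem_top hs)] at h2
  omega

lemma pseudo_insert_s19 {n k : ℕ} {s : Finset (ℕ × ℕ)} (hs : IsPseudo n s) (hk : k ∈ unp n s) :
    IsPseudo (n + 1) (insert (k, n + 1) s) := by
  have hk := mem_unp.1 hk
  refine ⟨?_, ?_⟩
  · intro q hq
    rcases Finset.mem_insert.1 hq with rfl | hq
    · simp only
      omega
    · have := hs.1 q hq
      omega
  · intro q hq r hr hne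
    rcases Finset.mem_insert.1 hq with rfl | hq <;>
      rcases Finset.mem_insert.1 hr with rfl | hr
    · exact absurd rfl hne
    · have a := hk.2 r hr
      have b := hs.1 r hr
      simp only
      omega
    · have a := hk.2 q hq
      have b := hs.1 q hq
      simp only
      omega
    · exact hs.2 q hq r hr hne

/-- the number of unpaired positions after extension -/
lemma unp_ext {n : ℕ} {s s' : Finset (ℕ × ℕ)} (hs : IsPseudo n s)
    (hs' : IsPseudo (n + 1) s') (h : ExtendsTo n s s') :
    (unp n s).card ≤ (unp (n + 1) s').card + 1 := by
  rcases h with rfl | ⟨k, _, _, _, rfl⟩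
  · have := unp_same hs
    omega
  · have := unp_insert hs hs'
    omega

lemma dg_mono_s19 {n : ℕ} {s t : Finset (ℕ × ℕ)} (hs : IsPseudo n s) (ht : IsPseudo n t)
    (h1 : 1 ≤ (unp n t).card) (h : (unp n t).card ≤ (unp n s).card) : dg n t ≤ dg n s := by
  have a := dg_eq_s19 hs
  have b := dg_eq_s19 ht
  nlinarith

lemma le_of_dg {n : ℕ} {s t : Finset (ℕ × ℕ)} (hs : IsPseudo n s) (ht : IsPseudo n t)
    (h : dg n t ≤ dg n s) : (unp n t).card ≤ (unp n s).card ∨ (unp n t).card ≤ 2 := by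
  have a := dg_eq_s19 hs
  have b := dg_eq_s19 ht
  by_contra! hc
  nlinarith

lemma succ_of_insert {n k : ℕ} (hn : Even n) {s t s' : Finset (ℕ × ℕ)}
    (hs : IsPseudo n s) (ht : IsPseudo n t) (hd : dg n t ≤ dg n s)
    (hs' : IsPseudo (n + 1) s') (ht' : IsPseudo (n + 1) (insert (k, n + 1) t))
    (he : ExtendsTo n s s') :
    dg (n + 1) (insert (k, n + 1) t) ≤ dg (n + 1) s' := by
  obtain ⟨m, hm⟩ := hn
  have c1 := card_unp hs
  have c2 := card_unp ht
  have c3 := card_unp hs'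
  have c4 := card_unp ht'
  have e1 := unp_ext hs hs' he
  have e2 := unp_insert ht ht'
  have e3 := le_of_dg hs ht hd
  apply dg_mono_s19 hs' ht' <;> omega

lemma unp_nonempty_of_fail {n : ℕ} (hn : Even n) {s t s' : Finset (ℕ × ℕ)}
    (ht : IsPseudo n t) (hs' : IsPseudo (n + 1) s')
    (hd : dg (n + 1) s' < dg (n + 1) t) : (unp n t).Nonempty := by
  rw [← Finset.card_pos]
  by_contra h0
  obtain ⟨m, hm⟩ := hn
  have c3 := card_unp hs'
  have e2 := unp_same ht
  have : dg (n + 1) t ≤ dg (n + 1) s' := by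
    apply dg_mono_s19 hs' (pseudo_succ ht) <;> omega
  omega

lemma finite_pseudo (n : ℕ) : {s | IsPseudo n s}.Finite := by
  apply Set.Finite.subset (Finset.finite_toSet (Finset.Icc 1 n ×ˢ Finset.Icc 1 n).powerset)
  intro s hs
  simp only [Finset.mem_coe, Finset.mem_powerset]
  intro p hp
  have := hs.1 p hp
  simp only [Finset.mem_product, Finset.mem_Icc]
  omega

lemma finite_succ (n : ℕ) : (SuccSet n).Finite := by
  apply Set.Finite.subset ((finite_pseudo n).prod ((finite_pseudo n).prod
    ((finite_pseudo (n + 1)).prod (finite_pseudo (n + 1)))))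
  rintro ⟨s, t, s', t'⟩ ⟨h1, h2, -, -, h3, h4, -⟩
  exact ⟨h1, h2, h3, h4⟩

open Classical in
/-- A canonical extension of `t` pairing position `n+1`. -/
noncomputable def extTop (n : ℕ) (t : Finset (ℕ × ℕ)) : Finset (ℕ × ℕ) :=
  insert ((if h : (unp n t).Nonempty then (unp n t).min' h else 0), n + 1) t

lemma fail_same {n : ℕ} (hn : Even n) {s t s' t' : Finset (ℕ × ℕ)}
    (h : (s, t, s', t') ∈ FailSet n) : t' = t := by
  obtain ⟨hs, ht, _, hd, hs', ht', he, he', hlt⟩ := h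
  simp only at *
  rcases he' with h | ⟨k, _, _, _, rfl⟩
  · exact h
  · have := succ_of_insert hn hs ht hd hs' ht' he
    omega

theorem stmt_19 (n : ℕ) (hn : Even n) (h4 : 4 ≤ n) :
    Set.ncard (SuccSet n) > Set.ncard (FailSet n) := by
  set F : Finset (ℕ × ℕ) × Finset (ℕ × ℕ) × Finset (ℕ × ℕ) × Finset (ℕ × ℕ) →
    Finset (ℕ × ℕ) × Finset (ℕ × ℕ) × Finset (ℕ × ℕ) × Finset (ℕ × ℕ) :=
    fun x => (x.1, x.2.1, x.2.2.1, extTop n x.2.1) with hF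
  have hinj : Set.InjOn F (FailSet n) := by
    rintro ⟨s, t, s', t'⟩ h ⟨a, b, a', b'⟩ h2 heq
    have e1 := fail_same hn h
    have e2 := fail_same hn h2
    simp only [hF, Prod.mk.injEq] at heq
    obtain ⟨rfl, rfl, rfl, -⟩ := heq
    rw [e1, e2]
  rw [gt_iff_lt, ← Set.ncard_image_of_injOn hinj]
  apply Set.ncard_lt_ncard _ (finite_succ n)
  rw [Set.ssubset_iff_of_subset]
  · have p0 : IsPseudo n ∅ := ⟨by simp, by simp⟩
    have p1 : IsPseudo n {(1, 2)} := by
      refine ⟨?_, ?_⟩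
      · intro p hp
        rw [Finset.mem_singleton] at hp
        subst hp
        simp only
        omega
      · intro p hp q hq hne
        rw [Finset.mem_singleton] at hp hq
        exact absurd (hp.trans hq.symm) hne
    have c0 := card_unp p0
    have c1 := card_unp p1
    have d0 := unp_same p0
    have d1 := unp_same p1
    simp only [Finset.card_empty, Finset.card_singleton] at c0 c1
    refine ⟨(∅, {(1, 2)}, ∅, {(1, 2)}), ⟨p0, p1, (Finset.singleton_ne_empty _).symm, ?_,
      pseudo_succ p0, pseudo_succ p1, Or.inl rfl, Or.inl rfl, ?_⟩, ?_⟩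
    · apply dg_mono_s19 p0 p1 <;> omega
    · apply dg_mono_s19 (pseudo_succ p0) (pseudo_succ p1) <;> omega
    · rintro ⟨⟨s, t, s', t'⟩, h, heq⟩
      simp only [hF, Prod.mk.injEq] at heq
      obtain ⟨rfl, rfl, rfl, h5⟩ := heq
      apply notMem_top p1
      rw [← h5]
      exact Finset.mem_insert_self _ _
  · rintro _ ⟨⟨s, t, s', t'⟩, h, rfl⟩
    have e1 := fail_same hn h
    subst e1
    obtain ⟨hs, ht, hne, hd, hs', ht', he, he', hlt⟩ := h
    simp only at *
    have hU := unp_nonempty_of_fail (s := s) hn ht hs' hlt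
    have hk := Finset.min'_mem _ hU
    have hE : extTop n t' = insert ((unp n t').min' hU, n + 1) t' := by
      unfold extTop
      rw [dif_pos hU]
    have hp := pseudo_insert_s19 ht hk
    have hk' := mem_unp.1 hk
    have hfin := succ_of_insert hn hs ht hd hs' hp he
    rw [← hE] at hp hfin
    exact ⟨hs, ht, hne, hd, hs', hp, he,
      Or.inr ⟨_, hk'.1.1, hk'.1.2, hk'.2, hE⟩, hfin⟩
end
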